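/- Bilinear anti-divergence operator: Let d ≥ 2. There exists a bilinear operator ℬ mapping a pair (v, M), where v : 𝕋^d → ℝ^d is a smooth vector field and M : 𝕋^d → ℝ^{d×d} is a smooth mean-zero matrix field, to a smooth symmetric trace-free matrix field ℬ(v, M) : 𝕋^d → ℝ^{d×d} such that: (i) div(ℬ(v, M)) = Mv − ∫_{𝕋^d} Mv dx, where Mv denotes the vector field x ↦ M(x)v(x); (ii) for every p ∈ [1, ∞] there is a constant C_p > 0 with ‖ℬ(v, M)‖_{L^p(𝕋^d)} ≤ C_p ‖v‖_{C¹} ‖M‖_{L^p(𝕋^d)}. -/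

import Mathlib

noncomputable section

open MeasureTheory ENNReal

/-- The unit cube in `ℝ^d`, a fundamental domain for the torus `𝕋^d = ℝ^d/ℤ^d`. -/
def cube (d : ℕ) : Set (Fin d → ℝ) := Set.Icc 0 1

/-- A function on `ℝ^d` is `ℤ^d`-periodic, i.e. descends to the torus `𝕋^d`. -/
def ZPeriodic {d : ℕ} {E : Type*} (f : (Fin d → ℝ) → E) : Prop :=
  ∀ (x : Fin d → ℝ) (k : Fin d → ℤ), f (fun i => x i + (k i : ℝ)) = f x

/-- Partial derivative `∂_j g` of a real-valued function on `ℝ^d`. -/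
def pd {d : ℕ} (j : Fin d) (g : (Fin d → ℝ) → ℝ) (x : Fin d → ℝ) : ℝ :=
  fderiv ℝ g x (Pi.single j 1)

/-- The `C¹` norm `‖v‖_{C¹} = sup |v| + ∑ᵢ sup |∂ᵢ v|` of a vector field. -/
def C1NormVec {d : ℕ} (v : (Fin d → ℝ) → Fin d → ℝ) : ℝ :=
  (⨆ x, ‖v x‖) + ∑ i, ⨆ x, ‖fderiv ℝ v x (Pi.single i 1)‖

/-- A smooth vector field on the torus `𝕋^d`. -/
def SmoothField (d : ℕ) (v : (Fin d → ℝ) → Fin d → ℝ) : Prop :=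
  ContDiff ℝ (⊤ : ℕ∞) v ∧ ZPeriodic v

/-- A smooth mean-zero matrix field on the torus `𝕋^d`. -/
def SmoothMeanZeroMatrix (d : ℕ) (M : (Fin d → ℝ) → Fin d → Fin d → ℝ) : Prop :=
  ContDiff ℝ (⊤ : ℕ∞) M ∧ ZPeriodic M ∧ ∀ i j, (∫ x in cube d, M x i j) = 0


/-! ### Smooth periodic functions -/

/-- The algebra of smooth periodic functions. -/
def SP (d : ℕ) : Subalgebra ℝ ((Fin d → ℝ) → ℝ) where
  carrier := {f | ContDiff ℝ (⊤ : ℕ∞) f ∧ ZPeriodic f}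
  mul_mem' := fun {f g} hf hg => ⟨hf.1.mul hg.1, fun x k => by
    simp only [Pi.mul_apply]; rw [hf.2 x k, hg.2 x k]⟩
  add_mem' := fun {f g} hf hg => ⟨hf.1.add hg.1, fun x k => by
    simp only [Pi.add_apply]; rw [hf.2 x k, hg.2 x k]⟩
  algebraMap_mem' := fun r => ⟨contDiff_const, fun x k => rfl⟩

theorem SP.smooth {d : ℕ} (f : SP d) : ContDiff ℝ (⊤ : ℕ∞) (f : (Fin d → ℝ) → ℝ) := f.2.1
theorem SP.per {d : ℕ} (f : SP d) : ZPeriodic (f : (Fin d → ℝ) → ℝ) := f.2.2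
theorem SP.cont {d : ℕ} (f : SP d) : Continuous (f : (Fin d → ℝ) → ℝ) := f.2.1.continuous
theorem SP.diff {d : ℕ} (f : SP d) : Differentiable ℝ (f : (Fin d → ℝ) → ℝ) :=
  f.2.1.differentiable (by simp)

theorem periodic_bounded {d : ℕ} {E : Type*} [NormedAddCommGroup E] {f : (Fin d → ℝ) → E}
    (hc : Continuous f) (hp : ZPeriodic f) : ∃ C : ℝ, 0 ≤ C ∧ ∀ x, ‖f x‖ ≤ C := by
  have hcomp : IsCompact (cube d) := isCompact_Icc
  obtain ⟨C, hC⟩ := hcomp.exists_bound_of_continuousOn hc.continuousOn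
  refine ⟨max C 0, le_max_right _ _, fun x => ?_⟩
  have := hp x (fun i => - ⌊x i⌋)
  rw [← this]
  refine (hC _ ?_).trans (le_max_left _ _)
  constructor
  · intro i
    have := Int.floor_le (x i)
    simpa using this
  · intro i
    have := Int.lt_floor_add_one (x i)
    simp; linarith

theorem periodic_fderiv {d : ℕ} {E : Type*} [NormedAddCommGroup E] [NormedSpace ℝ E]
    {f : (Fin d → ℝ) → E} (hp : ZPeriodic f) : ZPeriodic (fderiv ℝ f) := by
  intro x k
  have h : (fun y : Fin d → ℝ => f (y + fun i => (k i : ℝ))) = f := by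
    funext y; exact hp y k
  have h2 := fderiv_comp_add_right (𝕜 := ℝ) (f := f) (x := x) (fun i => (k i : ℝ))
  rw [h] at h2
  exact h2.symm

/-- The partial derivative as an endomorphism of `SP d`. -/
def Dop {d : ℕ} (j : Fin d) : Module.End ℝ (SP d) where
  toFun f := ⟨pd j f, by
    constructor
    · exact ((SP.smooth f).fderiv_right (m := (⊤ : ℕ∞)) (by simp)).clm_apply contDiff_const
    · intro x k
      unfold pd
      rw [periodic_fderiv (SP.per f) x k]⟩
  map_add' f g := by
    ext x
    change pd j (f + g : (Fin d → ℝ) → ℝ) x = pd j f x + pd j g x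
    unfold pd
    rw [fderiv_add ((SP.diff f) x) ((SP.diff g) x)]; rfl
  map_smul' c f := by
    ext x
    change pd j (c • f : (Fin d → ℝ) → ℝ) x = c * pd j f x
    unfold pd
    rw [fderiv_const_smul ((SP.diff f) x)]; rfl

theorem Dop_apply {d : ℕ} (j : Fin d) (f : SP d) (x) : (Dop j f : (Fin d → ℝ) → ℝ) x = pd j f x := rfl

theorem Dop_mul {d : ℕ} (j : Fin d) (f g : SP d) : Dop j (f * g) = Dop j f * g + f * Dop j g := by
  ext x
  change pd j (f * g : (Fin d → ℝ) → ℝ) x = pd j f x * g.1 x + f.1 x * pd j g x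
  unfold pd
  rw [fderiv_mul ((SP.diff f) x) ((SP.diff g) x)]
  simp; ring

/-- Kernel data. -/
structure Ker (d : ℕ) where
  Om : Type
  [ms : MeasurableSpace Om]
  P : Measure Om
  [fin : IsFiniteMeasure P]
  w : Om → ℝ
  hw : Measurable w
  bd : ∃ C : ℝ, 0 ≤ C ∧ ∀ o, ‖w o‖ ≤ C
  Y : Om → (Fin d → ℝ)
  hY : Measurable Y

attribute [instance] Ker.ms Ker.fin

/-- raw kernel operator -/
def Ker.fn {d : ℕ} (K : Ker d) (f : (Fin d → ℝ) → ℝ) (x : Fin d → ℝ) : ℝ :=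
  ∫ o, K.w o * f (x + K.Y o) ∂K.P

theorem Ker.integrable {d : ℕ} (K : Ker d) (f : SP d) (x : Fin d → ℝ) :
    Integrable (fun o => K.w o * (f : (Fin d → ℝ) → ℝ) (x + K.Y o)) K.P := by
  obtain ⟨C, hC0, hC⟩ := K.bd
  obtain ⟨B, hB0, hB⟩ := periodic_bounded (SP.cont f) (SP.per f)
  have := K.hY
  have := K.hw
  have := (SP.cont f).measurable
  refine Integrable.of_bound (C := C * B) (Measurable.aestronglyMeasurable (by fun_prop)) ?_
  refine Filter.Eventually.of_forall fun o => ?_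
  rw [norm_mul]
  exact mul_le_mul (hC _) (hB _) (norm_nonneg _) hC0

theorem Ker.fn_hasFDeriv {d : ℕ} (K : Ker d) (f : SP d) (x : Fin d → ℝ) :
    HasFDerivAt (K.fn f) (∫ o, K.w o • fderiv ℝ (f : (Fin d → ℝ) → ℝ) (x + K.Y o) ∂K.P) x := by
  obtain ⟨C, hC0, hC⟩ := K.bd
  have hfc : Continuous (fderiv ℝ (f : (Fin d → ℝ) → ℝ)) := (SP.smooth f).continuous_fderiv (by simp)
  obtain ⟨B, hB0, hB⟩ := periodic_bounded hfc (periodic_fderiv (SP.per f))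
  have hY := K.hY
  have hw := K.hw
  have hm := (SP.cont f).measurable
  refine hasFDerivAt_integral_of_dominated_of_fderiv_le (s := Set.univ)
    (F := fun x o => K.w o * (f : (Fin d → ℝ) → ℝ) (x + K.Y o))
    (F' := fun x o => K.w o • fderiv ℝ (f : (Fin d → ℝ) → ℝ) (x + K.Y o))
    (bound := fun _ => C * B) Filter.univ_mem ?_ (K.integrable f x) ?_ ?_ ?_ ?_
  · exact Filter.Eventually.of_forall fun y => (K.integrable f y).aestronglyMeasurable
  · refine hw.aestronglyMeasurable.smul ?_
    exact hfc.comp_aestronglyMeasurable (Measurable.aestronglyMeasurable (by fun_prop))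
  · refine Filter.Eventually.of_forall fun o y _ => ?_
    rw [norm_smul]
    exact mul_le_mul (hC _) (hB _) (norm_nonneg _) hC0
  · exact integrable_const _
  · refine Filter.Eventually.of_forall fun o y _ => ?_
    have := ((SP.diff f) (y + K.Y o)).hasFDerivAt
    have h2 : HasFDerivAt (fun z : Fin d → ℝ => z + K.Y o)
        (ContinuousLinearMap.id ℝ (Fin d → ℝ)) y := (hasFDerivAt_id y).add_const _
    exact (this.comp y h2).const_mul (K.w o)

theorem Ker.fn_pd {d : ℕ} (K : Ker d) (f : SP d) (j : Fin d) (x : Fin d → ℝ) :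
    pd j (K.fn f) x = K.fn (Dop j f) x := by
  unfold pd
  rw [(K.fn_hasFDeriv f x).fderiv, ContinuousLinearMap.integral_apply]
  · rfl
  · obtain ⟨C, hC0, hC⟩ := K.bd
    have hfc : Continuous (fderiv ℝ (f : (Fin d → ℝ) → ℝ)) := (SP.smooth f).continuous_fderiv (by simp)
    obtain ⟨B, hB0, hB⟩ := periodic_bounded hfc (periodic_fderiv (SP.per f))
    have hY := K.hY
    have hw := K.hw
    refine Integrable.of_bound (C := C * B) ?_ ?_
    · refine hw.aestronglyMeasurable.smul ?_
      exact hfc.comp_aestronglyMeasurable (Measurable.aestronglyMeasurable (by fun_prop))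
    · refine Filter.Eventually.of_forall fun o => ?_
      rw [norm_smul]
      exact mul_le_mul (hC _) (hB _) (norm_nonneg _) hC0

theorem clm_pi_decomp {d : ℕ} (L : (Fin d → ℝ) →L[ℝ] ℝ) :
    L = ∑ j, L (Pi.single j 1) • ContinuousLinearMap.proj (R := ℝ) (φ := fun _ : Fin d => ℝ) j := by
  ext v
  conv_lhs => rw [pi_eq_sum_univ' v]
  simp [mul_comm]

theorem Ker.fn_contDiff {d : ℕ} (K : Ker d) (n : ℕ) : ∀ f : SP d, ContDiff ℝ n (K.fn f) := by
  induction n with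
  | zero =>
    intro f
    have : Differentiable ℝ (K.fn f) := fun x => (K.fn_hasFDeriv f x).differentiableAt
    exact contDiff_zero.2 this.continuous
  | succ n ih =>
    intro f
    have hd : Differentiable ℝ (K.fn f) := fun x => (K.fn_hasFDeriv f x).differentiableAt
    have : fderiv ℝ (K.fn f) = fun x => ∑ j, K.fn (Dop j f) x •
        ContinuousLinearMap.proj (R := ℝ) (φ := fun _ : Fin d => ℝ) j := by
      funext x
      rw [clm_pi_decomp (fderiv ℝ (K.fn f) x)]
      refine Finset.sum_congr rfl fun j _ => ?_
      rw [← K.fn_pd f j x]; rfl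
    rw [show ((n + 1 : ℕ) : WithTop ℕ∞) = (n : WithTop ℕ∞) + 1 by simp, contDiff_succ_iff_fderiv]
    refine ⟨hd, by simp, ?_⟩
    rw [this]
    exact ContDiff.sum fun j _ => (ih _).smul contDiff_const

/-- Kernel operator as endomorphism. -/
def Ker.op {d : ℕ} (K : Ker d) : Module.End ℝ (SP d) where
  toFun f := ⟨K.fn f, contDiff_infty.2 fun n => K.fn_contDiff n f, by
    intro x k
    unfold Ker.fn
    congr 1
    funext o
    congr 1
    have := (SP.per f) (x + K.Y o) k
    rw [← this]
    refine congrArg (f : (Fin d → ℝ) → ℝ) ?_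
    funext i
    simp; ring⟩
  map_add' f g := by
    ext x
    change K.fn (f + g : (Fin d → ℝ) → ℝ) x = K.fn f x + K.fn g x
    unfold Ker.fn
    rw [← integral_add (K.integrable f x) (K.integrable g x)]
    simp [mul_add]
  map_smul' c f := by
    ext x
    change K.fn (c • f : (Fin d → ℝ) → ℝ) x = c * K.fn f x
    unfold Ker.fn
    rw [← integral_const_mul]
    congr 1
    funext o
    simp; ring

theorem Ker.op_apply {d : ℕ} (K : Ker d) (f : SP d) (x : Fin d → ℝ) :
    (K.op f : (Fin d → ℝ) → ℝ) x = ∫ o, K.w o * (f : (Fin d → ℝ) → ℝ) (x + K.Y o) ∂K.P := rfl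

theorem Ker.commute_D {d : ℕ} (K : Ker d) (j : Fin d) : Commute (Dop j) K.op := by
  refine LinearMap.ext fun f => ?_
  ext x
  exact K.fn_pd f j x

theorem Ker.commute {d : ℕ} (K L : Ker d) : Commute K.op L.op := by
  refine LinearMap.ext fun f => ?_
  ext x
  change (K.op (L.op f) : (Fin d → ℝ) → ℝ) x = (L.op (K.op f) : (Fin d → ℝ) → ℝ) x
  rw [K.op_apply, L.op_apply]
  simp only [Ker.op_apply]
  simp only [← integral_const_mul]
  rw [integral_integral_swap]
  · refine integral_congr_ae (Filter.Eventually.of_forall fun o => ?_)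
    refine integral_congr_ae (Filter.Eventually.of_forall fun o' => ?_)
    simp only []
    rw [add_right_comm]; ring
  · obtain ⟨C, hC0, hC⟩ := K.bd
    obtain ⟨C', hC0', hC'⟩ := L.bd
    obtain ⟨B, hB0, hB⟩ := periodic_bounded (SP.cont f) (SP.per f)
    have := K.hY
    have := K.hw
    have := L.hY
    have := L.hw
    have := (SP.cont f).measurable
    refine Integrable.of_bound (C := C * (C' * B)) (Measurable.aestronglyMeasurable ?_) ?_
    · unfold Function.uncurry
      fun_prop
    refine Filter.Eventually.of_forall fun o => ?_
    simp only [Function.uncurry]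
    rw [norm_mul, norm_mul]
    exact mul_le_mul (hC _) (mul_le_mul (hC' _) (hB _) (norm_nonneg _) hC0') (by positivity) hC0

/-! ### Translation invariance of integrals over the cube, and `L^p` bounds -/

theorem span_per {d : ℕ} {E : Type*} {F : (Fin d → ℝ) → E} (hF : ZPeriodic F)
    (g : (Submodule.span ℤ (Set.range (Pi.basisFun ℝ (Fin d)))).toAddSubgroup) (x : Fin d → ℝ) :
    F (g +ᵥ x) = F x := by
  have aux : ∀ g ∈ Submodule.span ℤ (Set.range (Pi.basisFun ℝ (Fin d))),
      ∃ k : Fin d → ℤ, g = fun i => (k i : ℝ) := by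
    intro g hg
    induction hg using Submodule.span_induction with
    | mem y hy =>
      obtain ⟨i, rfl⟩ := hy
      refine ⟨Pi.single i 1, ?_⟩
      funext j
      simp [Pi.single_apply]
    | zero => exact ⟨0, by funext i; simp⟩
    | add a b _ _ ha hb =>
      obtain ⟨ka, rfl⟩ := ha
      obtain ⟨kb, rfl⟩ := hb
      exact ⟨ka + kb, by funext i; simp⟩
    | smul c a _ ha =>
      obtain ⟨ka, rfl⟩ := ha
      exact ⟨c • ka, by funext i; simp⟩
  obtain ⟨g, hg⟩ := g
  obtain ⟨k, rfl⟩ := aux g hg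
  rw [← hF x k]
  congr 1
  funext i
  change (k i : ℝ) + x i = _
  rw [add_comm]

theorem cube_ae (d : ℕ) :
    (ZSpan.fundamentalDomain (Pi.basisFun ℝ (Fin d))) =ᵐ[volume] cube d := by
  rw [ZSpan.fundamentalDomain_pi_basisFun]
  exact Measure.univ_pi_Ico_ae_eq_Icc (f := fun _ : Fin d => (0 : ℝ)) (g := fun _ => 1)

theorem restrict_cube (d : ℕ) : (volume.restrict (cube d) : Measure (Fin d → ℝ)) =
    volume.restrict (ZSpan.fundamentalDomain (Pi.basisFun ℝ (Fin d))) :=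
  (Measure.restrict_congr_set (cube_ae d)).symm

theorem lint_translate {d : ℕ} (F : (Fin d → ℝ) → ℝ≥0∞) (hF : ZPeriodic F) (y : Fin d → ℝ) :
    ∫⁻ x in cube d, F (x + y) = ∫⁻ x in cube d, F x := by
  rw [restrict_cube]
  have : Countable (Submodule.span ℤ (Set.range (Pi.basisFun ℝ (Fin d)))).toAddSubgroup :=
    inferInstanceAs (Countable (Submodule.span ℤ (Set.range (Pi.basisFun ℝ (Fin d)))))
  have h1 := ZSpan.isAddFundamentalDomain' (Pi.basisFun ℝ (Fin d)) volume
  have h2 := h1.vadd_of_comm y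
  rw [h1.setLIntegral_eq h2 F (fun g x => span_per hF g x)]
  have hmp : MeasurePreserving (fun x : Fin d → ℝ => y + x) volume volume :=
    measurePreserving_add_left volume y
  have hemb : MeasurableEmbedding (fun x : Fin d → ℝ => y + x) :=
    measurableEmbedding_addLeft y
  have := hmp.setLIntegral_comp_emb hemb F (ZSpan.fundamentalDomain (Pi.basisFun ℝ (Fin d)))
  simp only [add_comm] at *
  exact this

theorem int_translate {d : ℕ} (F : (Fin d → ℝ) → ℝ) (hF : ZPeriodic F) (y : Fin d → ℝ) :
    ∫ x in cube d, F (x + y) = ∫ x in cube d, F x := by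
  rw [restrict_cube]
  have : Countable (Submodule.span ℤ (Set.range (Pi.basisFun ℝ (Fin d)))).toAddSubgroup :=
    inferInstanceAs (Countable (Submodule.span ℤ (Set.range (Pi.basisFun ℝ (Fin d)))))
  have h1 := ZSpan.isAddFundamentalDomain' (Pi.basisFun ℝ (Fin d)) volume
  have h2 := h1.vadd_of_comm y
  rw [h1.setIntegral_eq h2 (fun g x => span_per hF g x)]
  have hmp : MeasurePreserving (fun x : Fin d → ℝ => y + x) volume volume :=
    measurePreserving_add_left volume y
  have hemb : MeasurableEmbedding (fun x : Fin d → ℝ => y + x) :=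
    measurableEmbedding_addLeft y
  have := hmp.setIntegral_image_emb hemb F (ZSpan.fundamentalDomain (Pi.basisFun ℝ (Fin d)))
  simp only [add_comm] at *
  exact this.symm

theorem volume_cube (d : ℕ) : (volume : Measure (Fin d → ℝ)) (cube d) = 1 := by
  unfold cube
  rw [Real.volume_Icc_pi]
  simp

instance cube_prob (d : ℕ) : IsProbabilityMeasure
    (volume.restrict (cube d) : Measure (Fin d → ℝ)) :=
  ⟨by rw [Measure.restrict_apply_univ]; exact volume_cube d⟩

theorem le_of_ae_cube {d : ℕ} (f : SP d) (K : ℝ≥0∞)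
    (h : ∀ᵐ x ∂(volume.restrict (cube d)), ‖(f : (Fin d → ℝ) → ℝ) x‖ₑ ≤ K) (x : Fin d → ℝ) :
    ‖(f : (Fin d → ℝ) → ℝ) x‖ₑ ≤ K := by
  by_contra hx
  push Not at hx
  set S : Set (Fin d → ℝ) := {z | K < ‖(f : (Fin d → ℝ) → ℝ) z‖ₑ} with hS
  have hSo : IsOpen S := isOpen_lt continuous_const (SP.cont f).enorm
  have hFp : ZPeriodic (S.indicator (fun _ => (1 : ℝ≥0∞))) := by
    intro z k
    have : (fun i => z i + (k i : ℝ)) ∈ S ↔ z ∈ S := by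
      simp only [hS, Set.mem_ofPred_eq]
      rw [SP.per f z k]
    by_cases hz : z ∈ S
    · rw [Set.indicator_of_mem hz, Set.indicator_of_mem (this.2 hz)]
    · rw [Set.indicator_of_notMem hz, Set.indicator_of_notMem (fun h => hz (this.1 h))]
  set c : Fin d → ℝ := fun _ => 1 / 2 with hc
  have h0 : ∫⁻ z in cube d, S.indicator (fun _ => (1 : ℝ≥0∞)) z = 0 := by
    rw [lintegral_indicator hSo.measurableSet, lintegral_one, Measure.restrict_apply_univ]
    rw [ae_iff] at h
    simpa [hS] using h
  rw [← lint_translate _ hFp (x - c)] at h0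
  set S' : Set (Fin d → ℝ) := (fun z => z + (x - c)) ⁻¹' S with hS'
  have hSo' : IsOpen S' := hSo.preimage (by fun_prop)
  have h1 : (fun z => S.indicator (fun _ => (1 : ℝ≥0∞)) (z + (x - c))) =
      S'.indicator (fun _ => 1) := by
    funext z; rfl
  rw [h1, lintegral_indicator hSo'.measurableSet, lintegral_one, Measure.restrict_apply_univ,
    Measure.restrict_apply hSo'.measurableSet] at h0
  set I : Set (Fin d → ℝ) := Set.pi Set.univ (fun _ => Set.Ioo (0 : ℝ) 1) with hI
  have hIo : IsOpen I := isOpen_set_pi Set.finite_univ (fun _ _ => isOpen_Ioo)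
  have h2 : volume (S' ∩ I) = 0 := by
    refine measure_mono_null ?_ h0
    refine Set.inter_subset_inter_right _ ?_
    intro z hz
    exact ⟨fun i => (hz i trivial).1.le, fun i => (hz i trivial).2.le⟩
  rw [IsOpen.measure_eq_zero_iff (μ := volume) (hSo'.inter hIo)] at h2
  have : c ∈ S' ∩ I := by
    refine ⟨?_, fun i _ => by simp [hc]; norm_num⟩
    change c + (x - c) ∈ S
    rw [add_sub_cancel]
    exact hx
  rw [h2] at this
  exact this

theorem jensen_aux {Om : Type*} [MeasurableSpace Om] (P : Measure Om) {F : Om → ℝ}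
    (hF : AEStronglyMeasurable F P) {r : ℝ} (hr : 1 ≤ r) :
    (∫⁻ o, ‖F o‖ₑ ∂P) ^ r ≤ P Set.univ ^ (r - 1) * ∫⁻ o, ‖F o‖ₑ ^ r ∂P := by
  have h := eLpNorm'_le_eLpNorm'_mul_rpow_measure_univ (one_pos) hr hF
  have hr0 : 0 < r := by linarith
  simp only [eLpNorm', ENNReal.rpow_one, ne_eq, one_ne_zero, not_false_eq_true, div_self] at h
  have h2 := ENNReal.rpow_le_rpow h hr0.le
  rw [ENNReal.mul_rpow_of_nonneg _ _ hr0.le, ← ENNReal.rpow_mul, ← ENNReal.rpow_mul] at h2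
  rw [show 1 / r * r = 1 by field_simp, show (1 - 1 / r) * r = r - 1 by field_simp,
    ENNReal.rpow_one, mul_comm] at h2
  exact h2

/-- Boundedness in all `L^p`. -/
def Bnd {d : ℕ} (T : Module.End ℝ (SP d)) : Prop :=
  ∃ C : ℝ, 0 ≤ C ∧ ∀ p : ℝ≥0∞, 1 ≤ p → ∀ f : SP d,
    eLpNorm (T f : (Fin d → ℝ) → ℝ) p (volume.restrict (cube d)) ≤
      ENNReal.ofReal C * eLpNorm (f : (Fin d → ℝ) → ℝ) p (volume.restrict (cube d))

theorem Ker.enorm_le {d : ℕ} (K : Ker d) {C : ℝ} (hC : ∀ o, ‖K.w o‖ ≤ C) (f : SP d)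
    (x : Fin d → ℝ) : ‖(K.op f : (Fin d → ℝ) → ℝ) x‖ₑ ≤
      ENNReal.ofReal C * ∫⁻ o, ‖(f : (Fin d → ℝ) → ℝ) (x + K.Y o)‖ₑ ∂K.P := by
  rw [K.op_apply]
  refine (enorm_integral_le_lintegral_enorm _).trans ?_
  have hY := K.hY
  have hm := (SP.cont f).measurable
  rw [← lintegral_const_mul _ (by fun_prop)]
  refine lintegral_mono fun o => ?_
  rw [enorm_mul]
  gcongr
  rw [← ofReal_norm]
  exact ENNReal.ofReal_le_ofReal (hC o)

theorem Ker.bnd {d : ℕ} (K : Ker d) : Bnd K.op := by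
  obtain ⟨C, hC0, hC⟩ := K.bd
  have hY := K.hY
  refine ⟨C * (K.P Set.univ).toReal, by positivity, fun p hp f => ?_⟩
  have hm := (SP.cont f).measurable
  have hPt : K.P Set.univ ≠ ⊤ := measure_ne_top _ _
  rw [ENNReal.ofReal_mul hC0, ENNReal.ofReal_toReal hPt]
  by_cases hpt : p = ⊤
  · subst hpt
    rw [eLpNorm_exponent_top, eLpNorm_exponent_top]
    have h1 := le_of_ae_cube f _ (enorm_ae_le_eLpNormEssSup (f : (Fin d → ℝ) → ℝ)
      (volume.restrict (cube d)))
    refine eLpNormEssSup_le_of_ae_enorm_bound (Filter.Eventually.of_forall fun x => ?_)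
    refine (K.enorm_le hC f x).trans ?_
    rw [mul_assoc]
    gcongr
    refine (lintegral_mono fun o => h1 _).trans ?_
    rw [lintegral_const, mul_comm]
  · have hp0 : p ≠ 0 := by
      rintro rfl; simp at hp
    rw [eLpNorm_eq_lintegral_rpow_enorm_toReal hp0 hpt, eLpNorm_eq_lintegral_rpow_enorm_toReal hp0 hpt]
    set r := p.toReal with hr
    have hr1 : 1 ≤ r := by
      have := ENNReal.toReal_mono hpt hp
      simpa using this
    have hr0 : 0 < r := by linarith
    have key : ∫⁻ x in cube d, ‖(K.op f : (Fin d → ℝ) → ℝ) x‖ₑ ^ r ≤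
        (ENNReal.ofReal C * K.P Set.univ) ^ r *
          ∫⁻ x in cube d, ‖(f : (Fin d → ℝ) → ℝ) x‖ₑ ^ r := by
      have hper : ZPeriodic (fun x => ‖(f : (Fin d → ℝ) → ℝ) x‖ₑ ^ r) := by
        intro x k
        simp only []
        rw [SP.per f x k]
      have hsw : ∫⁻ x in cube d, ∫⁻ o, ‖(f : (Fin d → ℝ) → ℝ) (x + K.Y o)‖ₑ ^ r ∂K.P =
          K.P Set.univ * ∫⁻ x in cube d, ‖(f : (Fin d → ℝ) → ℝ) x‖ₑ ^ r := by
        rw [lintegral_lintegral_swap]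
        · simp_rw [lint_translate _ hper]
          rw [lintegral_const, mul_comm]
        · refine Measurable.aemeasurable ?_
          unfold Function.uncurry
          fun_prop
      calc ∫⁻ x in cube d, ‖(K.op f : (Fin d → ℝ) → ℝ) x‖ₑ ^ r
          ≤ ∫⁻ x in cube d, (ENNReal.ofReal C) ^ r * (K.P Set.univ ^ (r - 1) *
              ∫⁻ o, ‖(f : (Fin d → ℝ) → ℝ) (x + K.Y o)‖ₑ ^ r ∂K.P) := by
            refine lintegral_mono fun x => ?_
            refine (ENNReal.rpow_le_rpow (K.enorm_le hC f x) hr0.le).trans ?_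
            rw [ENNReal.mul_rpow_of_nonneg _ _ hr0.le]
            gcongr
            exact jensen_aux K.P (Measurable.aestronglyMeasurable (by fun_prop)) hr1
        _ = (ENNReal.ofReal C) ^ r * (K.P Set.univ ^ (r - 1) * (K.P Set.univ *
              ∫⁻ x in cube d, ‖(f : (Fin d → ℝ) → ℝ) x‖ₑ ^ r)) := by
            have hmeas : Measurable fun x : Fin d → ℝ =>
                ∫⁻ o, ‖(f : (Fin d → ℝ) → ℝ) (x + K.Y o)‖ₑ ^ r ∂K.P := by
              refine Measurable.lintegral_prod_right' (f := fun z : (Fin d → ℝ) × K.Om =>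
                ‖(f : (Fin d → ℝ) → ℝ) (z.1 + K.Y z.2)‖ₑ ^ r) ?_
              fun_prop
            rw [lintegral_const_mul _ (by fun_prop), lintegral_const_mul _ hmeas, hsw]
        _ = _ := by
            rw [ENNReal.mul_rpow_of_nonneg _ _ hr0.le]
            have : K.P Set.univ ^ r = K.P Set.univ ^ (r - 1) * K.P Set.univ := by
              conv_lhs => rw [show r = (r - 1) + 1 by ring]
              rw [ENNReal.rpow_add_of_nonneg _ _ (by linarith) zero_le_one, ENNReal.rpow_one]
            rw [this]
            ring
    refine (ENNReal.rpow_le_rpow key (by positivity : 0 ≤ 1 / r)).trans ?_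
    rw [ENNReal.mul_rpow_of_nonneg _ _ (by positivity), ← ENNReal.rpow_mul,
      show r * (1 / r) = 1 by field_simp, ENNReal.rpow_one]

theorem Bnd.mul {d : ℕ} {S T : Module.End ℝ (SP d)} (hS : Bnd S) (hT : Bnd T) : Bnd (S * T) := by
  obtain ⟨C, hC0, hC⟩ := hS
  obtain ⟨C', hC0', hC'⟩ := hT
  refine ⟨C * C', by positivity, fun p hp f => ?_⟩
  refine (hC p hp (T f)).trans ?_
  rw [ENNReal.ofReal_mul hC0, mul_assoc]
  gcongr
  exact hC' p hp f

theorem SP.aesm {d : ℕ} (f : SP d) (μ : Measure (Fin d → ℝ)) :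
    AEStronglyMeasurable (f : (Fin d → ℝ) → ℝ) μ := (SP.cont f).aestronglyMeasurable

theorem Bnd.add {d : ℕ} {S T : Module.End ℝ (SP d)} (hS : Bnd S) (hT : Bnd T) : Bnd (S + T) := by
  obtain ⟨C, hC0, hC⟩ := hS
  obtain ⟨C', hC0', hC'⟩ := hT
  refine ⟨C + C', by positivity, fun p hp f => ?_⟩
  refine (eLpNorm_add_le (SP.aesm (S f) _) (SP.aesm (T f) _) hp).trans ?_
  rw [ENNReal.ofReal_add hC0 hC0', add_mul]
  exact add_le_add (hC p hp f) (hC' p hp f)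

theorem Bnd.smul {d : ℕ} {T : Module.End ℝ (SP d)} (c : ℝ) (hT : Bnd T) : Bnd (c • T) := by
  obtain ⟨C, hC0, hC⟩ := hT
  refine ⟨|c| * C, by positivity, fun p hp f => ?_⟩
  refine (eLpNorm_const_smul_le (c := c) (f := (T f : (Fin d → ℝ) → ℝ))).trans ?_
  rw [ENNReal.ofReal_mul (abs_nonneg c), mul_assoc, ← Real.norm_eq_abs, ofReal_norm]
  gcongr
  exact hC p hp f

theorem Bnd.one {d : ℕ} : Bnd (1 : Module.End ℝ (SP d)) :=
  ⟨1, zero_le_one, fun p _ f => by simp⟩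

theorem Bnd.zero {d : ℕ} : Bnd (0 : Module.End ℝ (SP d)) := by
  simpa using Bnd.smul 0 (Bnd.one (d := d))

theorem Bnd.sub {d : ℕ} {S T : Module.End ℝ (SP d)} (hS : Bnd S) (hT : Bnd T) : Bnd (S - T) := by
  rw [show S - T = S + (-1 : ℝ) • T by ext f x; simp [sub_eq_add_neg]]
  exact hS.add (hT.smul (-1))

theorem Bnd.sum {d : ℕ} {ι : Type*} (s : Finset ι) {T : ι → Module.End ℝ (SP d)}
    (h : ∀ i ∈ s, Bnd (T i)) : Bnd (∑ i ∈ s, T i) := by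
  classical
  induction s using Finset.induction_on with
  | empty => simpa using Bnd.zero
  | insert a s ha ih =>
    rw [Finset.sum_insert ha]
    exact (h a (by simp)).add (ih fun i hi => h i (by simp [hi]))

/-! ### Averaging operators -/

theorem line_deriv {d : ℕ} (f : SP d) (x v : Fin d → ℝ) (s : ℝ) :
    HasDerivAt (fun s : ℝ => (f : (Fin d → ℝ) → ℝ) (x + s • v))
      (fderiv ℝ (f : (Fin d → ℝ) → ℝ) (x + s • v) v) s := by
  have h1 : HasDerivAt (fun s : ℝ => x + s • v) v s := by
    simpa using ((hasDerivAt_id s).smul_const v).const_add x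
  exact ((SP.diff f) (x + s • v)).hasFDerivAt.comp_hasDerivAt s h1

theorem single_eq_smul {d : ℕ} (i : Fin d) (s : ℝ) :
    (Pi.single i s : Fin d → ℝ) = s • Pi.single i 1 := by
  funext j
  simp [Pi.single_apply]

theorem SP.pd_cont {d : ℕ} (f : SP d) (i : Fin d) : Continuous (pd i (f : (Fin d → ℝ) → ℝ)) :=
  SP.cont (Dop i f)

theorem SP.shift {d : ℕ} (f : SP d) (i : Fin d) (x : Fin d → ℝ) :
    (f : (Fin d → ℝ) → ℝ) (x + Pi.single i 1) = (f : (Fin d → ℝ) → ℝ) x := by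
  rw [← SP.per f x (Pi.single i 1)]
  refine congrArg (f : (Fin d → ℝ) → ℝ) ?_
  funext j
  simp [Pi.single_apply]

/-- Average in direction `i`. -/
def avg {d : ℕ} (i : Fin d) : Ker d where
  Om := ℝ
  P := volume.restrict (Set.Ioc 0 1)
  w := fun _ => 1
  hw := measurable_const
  bd := ⟨1, zero_le_one, fun _ => by simp⟩
  Y := fun s => Pi.single i s
  hY := by
    have : (fun s : ℝ => (Pi.single i s : Fin d → ℝ)) = fun s => s • Pi.single i 1 := by
      funext s; exact single_eq_smul i s
    rw [this]; fun_prop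

theorem avg_apply {d : ℕ} (i : Fin d) (f : SP d) (x : Fin d → ℝ) :
    ((avg i).op f : (Fin d → ℝ) → ℝ) x =
      ∫ s in Set.Ioc (0 : ℝ) 1, (f : (Fin d → ℝ) → ℝ) (x + Pi.single i s) := by
  rw [Ker.op_apply]
  change ∫ s in Set.Ioc (0 : ℝ) 1, (1 : ℝ) * (f : (Fin d → ℝ) → ℝ) (x + Pi.single i s) = _
  simp

theorem D_avg {d : ℕ} (i : Fin d) : Dop i * (avg i).op = 0 := by
  rw [(avg i).commute_D i]
  refine LinearMap.ext fun f => ?_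
  ext x
  change ((avg i).op (Dop i f) : (Fin d → ℝ) → ℝ) x = 0
  rw [avg_apply, ← intervalIntegral.integral_of_le zero_le_one]
  have h := intervalIntegral.integral_eq_sub_of_hasDerivAt
    (fun s _ => line_deriv f x (Pi.single i 1) s) (a := 0) (b := 1) ?_
  · simp_rw [← single_eq_smul i] at h
    rw [SP.shift] at h
    simpa [Dop_apply, pd] using h
  · refine Continuous.intervalIntegrable ?_ _ _
    exact (SP.pd_cont f i).comp (by fun_prop)

theorem avg_of_D {d : ℕ} (i : Fin d) (f : SP d) (h : Dop i f = 0) : (avg i).op f = f := by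
  ext x
  rw [avg_apply]
  have hc : ∀ s : ℝ, (f : (Fin d → ℝ) → ℝ) (x + Pi.single i s) = (f : (Fin d → ℝ) → ℝ) x := by
    intro s
    have hd : ∀ s, HasDerivAt (fun s : ℝ => (f : (Fin d → ℝ) → ℝ) (x + s • Pi.single i 1)) 0 s := by
      intro s
      have h1 := line_deriv f x (Pi.single i 1) s
      have h2 : fderiv ℝ (f : (Fin d → ℝ) → ℝ) (x + s • Pi.single i 1) (Pi.single i 1) = 0 := by
        change (Dop i f : (Fin d → ℝ) → ℝ) _ = 0
        rw [h]; rfl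
      rwa [h2] at h1
    have := is_const_of_deriv_eq_zero (fun s => (hd s).differentiableAt) (fun s => (hd s).deriv) s 0
    simpa [← single_eq_smul] using this
  simp [hc]

theorem avg_idem {d : ℕ} (i : Fin d) : (avg i).op * (avg i).op = (avg i).op := by
  refine LinearMap.ext fun f => ?_
  exact avg_of_D i _ (LinearMap.congr_fun (D_avg i) f)

theorem SP.integrable_cube {d : ℕ} (f : SP d) :
    Integrable (f : (Fin d → ℝ) → ℝ) (volume.restrict (cube d)) :=
  (SP.cont f).continuousOn.integrableOn_compact isCompact_Icc

theorem int_avg {d : ℕ} (i : Fin d) (f : SP d) :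
    ∫ x in cube d, ((avg i).op f : (Fin d → ℝ) → ℝ) x = ∫ x in cube d, (f : (Fin d → ℝ) → ℝ) x := by
  simp_rw [avg_apply]
  rw [integral_integral_swap]
  · simp_rw [int_translate _ (SP.per f)]
    simp
  · obtain ⟨B, hB0, hB⟩ := periodic_bounded (SP.cont f) (SP.per f)
    have := (SP.cont f).measurable
    have h3 := (avg i).hY
    simp only [avg] at h3
    refine Integrable.of_bound (C := B) (Measurable.aestronglyMeasurable ?_) ?_
    · unfold Function.uncurry
      fun_prop
    · exact Filter.Eventually.of_forall fun o => hB _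

/-- Average in the first `m` directions. -/
def PartAvg (d : ℕ) : ℕ → Module.End ℝ (SP d)
  | 0 => 1
  | m + 1 => (if h : m < d then (avg ⟨m, h⟩).op else 1) * PartAvg d m

theorem PartAvg_commute {d : ℕ} (T : Module.End ℝ (SP d)) (hT : ∀ i, Commute T (avg i).op) (m : ℕ) :
    Commute T (PartAvg d m) := by
  induction m with
  | zero => exact Commute.one_right _
  | succ m ih =>
    unfold PartAvg
    refine Commute.mul_right ?_ ih
    split_ifs with h
    · exact hT _
    · exact Commute.one_right _

theorem D_PartAvg {d : ℕ} (j : Fin d) (m : ℕ) (hj : (j : ℕ) < m) : Dop j * PartAvg d m = 0 := by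
  induction m with
  | zero => simp at hj
  | succ m ih =>
    unfold PartAvg
    by_cases hjm : (j : ℕ) = m
    · have hm : m < d := hjm ▸ j.2
      rw [dif_pos hm]
      have : (⟨m, hm⟩ : Fin d) = j := Fin.ext hjm.symm
      rw [this, ← mul_assoc, D_avg, zero_mul]
    · have h1 := ih (by omega)
      split_ifs with h
      · rw [← mul_assoc, ((avg ⟨m, h⟩).commute_D j).eq, mul_assoc, h1, mul_zero]
      · rw [one_mul, h1]

theorem PartAvg_bnd (d m : ℕ) : Bnd (PartAvg d m) := by
  induction m with
  | zero => exact Bnd.one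
  | succ m ih =>
    unfold PartAvg
    refine Bnd.mul ?_ ih
    split_ifs with h
    · exact Ker.bnd _
    · exact Bnd.one

theorem int_PartAvg {d : ℕ} (m : ℕ) (f : SP d) :
    ∫ x in cube d, (PartAvg d m f : (Fin d → ℝ) → ℝ) x = ∫ x in cube d, (f : (Fin d → ℝ) → ℝ) x := by
  induction m with
  | zero => rfl
  | succ m ih =>
    unfold PartAvg
    split_ifs with h
    · rw [← ih]
      exact int_avg _ _
    · rw [one_mul, ih]

theorem PartAvg_eq {d : ℕ} (f : SP d) (x : Fin d → ℝ) :
    (PartAvg d d f : (Fin d → ℝ) → ℝ) x = ∫ x in cube d, (f : (Fin d → ℝ) → ℝ) x := by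
  have hc : ∀ y, (PartAvg d d f : (Fin d → ℝ) → ℝ) y = (PartAvg d d f : (Fin d → ℝ) → ℝ) x := by
    intro y
    refine is_const_of_fderiv_eq_zero (SP.diff _) (fun z => ?_) y x
    rw [clm_pi_decomp (fderiv ℝ (PartAvg d d f : (Fin d → ℝ) → ℝ) z)]
    refine Finset.sum_eq_zero fun j _ => ?_
    have : fderiv ℝ (PartAvg d d f : (Fin d → ℝ) → ℝ) z (Pi.single j 1) = 0 := by
      change (Dop j (PartAvg d d f) : (Fin d → ℝ) → ℝ) z = 0
      have := LinearMap.congr_fun (D_PartAvg j d j.2) f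
      rw [Module.End.mul_apply] at this
      rw [this]; rfl
    rw [this, zero_smul]
  rw [← int_PartAvg d f]
  simp_rw [hc]
  simp

theorem PartAvg_D {d : ℕ} (j : Fin d) (f : SP d) : PartAvg d d (Dop j f) = 0 := by
  have h : Commute (Dop j) (PartAvg d d) := PartAvg_commute _ (fun i => (avg i).commute_D j) d
  have h2 := h.eq
  rw [D_PartAvg j d j.2] at h2
  exact (LinearMap.congr_fun h2 f).symm

/-- the pieces of the decomposition of the identity -/
def Qop {d : ℕ} (i : Fin d) : Module.End ℝ (SP d) := PartAvg d i - (avg i).op * PartAvg d i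

theorem Q_avg {d : ℕ} (i : Fin d) : (avg i).op * Qop i = 0 := by
  refine LinearMap.ext fun f => ?_
  change (avg i).op (PartAvg d i f - (avg i).op (PartAvg d i f)) = 0
  have h := LinearMap.congr_fun (avg_idem i) (PartAvg d i f)
  rw [Module.End.mul_apply] at h
  rw [map_sub, h, sub_self]

theorem Q_bnd {d : ℕ} (i : Fin d) : Bnd (Qop i) :=
  (PartAvg_bnd d i).sub ((avg i).bnd.mul (PartAvg_bnd d i))

theorem Q_sum {d : ℕ} (f : SP d) : ∑ i : Fin d, Qop i f = f - PartAvg d d f := by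
  have h : ∀ i : Fin d, Qop i f = (fun m => PartAvg d m f - PartAvg d (m + 1) f) i := by
    intro i
    simp only [Qop, PartAvg]
    rw [dif_pos i.2]
    rfl
  rw [Finset.sum_congr rfl (fun i _ => h i),
    Fin.sum_univ_eq_sum_range (fun m => PartAvg d m f - PartAvg d (m + 1) f) d]
  exact Finset.sum_range_sub' (fun m => PartAvg d m f) d

/-! ### Neumann series -/

/-- kernel of a measure -/
def kerOf {d : ℕ} (σ : Measure (Fin d → ℝ)) [IsFiniteMeasure σ] : Ker d where
  Om := Fin d → ℝ
  P := σ
  w := fun _ => 1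
  hw := measurable_const
  bd := ⟨1, zero_le_one, fun _ => by simp⟩
  Y := fun s => s
  hY := measurable_id

theorem kerOf_apply {d : ℕ} (σ : Measure (Fin d → ℝ)) [IsFiniteMeasure σ] (f : SP d)
    (x : Fin d → ℝ) : ((kerOf σ).op f : (Fin d → ℝ) → ℝ) x =
      ∫ y, (f : (Fin d → ℝ) → ℝ) (x + y) ∂σ := by
  rw [Ker.op_apply]
  change ∫ y, (1 : ℝ) * (f : (Fin d → ℝ) → ℝ) (x + y) ∂σ = _
  simp

theorem SP.integrable_shift {d : ℕ} (σ : Measure (Fin d → ℝ)) [IsFiniteMeasure σ] (f : SP d)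
    (x : Fin d → ℝ) : Integrable (fun y => (f : (Fin d → ℝ) → ℝ) (x + y)) σ := by
  have : Integrable (fun y => (1 : ℝ) * (f : (Fin d → ℝ) → ℝ) (x + y)) σ :=
    (kerOf σ).integrable f x
  simpa using this

/-- convolution powers -/
def cpow {d : ℕ} (σ : Measure (Fin d → ℝ)) : ℕ → Measure (Fin d → ℝ)
  | 0 => Measure.dirac 0
  | n + 1 => (cpow σ n).conv σ

theorem cpow_univ {d : ℕ} (σ : Measure (Fin d → ℝ)) [IsFiniteMeasure σ] (n : ℕ) :
    IsFiniteMeasure (cpow σ n) ∧ cpow σ n Set.univ = σ Set.univ ^ n := by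
  induction n with
  | zero =>
    refine ⟨?_, ?_⟩ <;> unfold cpow
    · infer_instance
    · simp
  | succ n ih =>
    have := ih.1
    refine ⟨?_, ?_⟩ <;> unfold cpow
    · infer_instance
    · unfold Measure.conv
      rw [Measure.map_apply (by fun_prop) MeasurableSet.univ, Set.preimage_univ,
        ← Set.univ_prod_univ, Measure.prod_prod, ih.2, pow_succ]

theorem neumann {d : ℕ} (σ : Measure (Fin d → ℝ)) [IsFiniteMeasure σ] (h : σ Set.univ < 1) :
    ∃ K : Ker d, K.op * (1 - (kerOf σ).op) = 1 := by
  have hfin : ∀ n, IsFiniteMeasure (cpow σ n) := fun n => (cpow_univ σ n).1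
  have hf : IsFiniteMeasure (Measure.sum (cpow σ)) := by
    refine ⟨?_⟩
    rw [Measure.sum_apply _ MeasurableSet.univ]
    simp_rw [fun n => (cpow_univ σ n).2]
    rw [ENNReal.tsum_geometric]
    rw [ENNReal.inv_lt_top]
    exact tsub_pos_of_lt h
  refine ⟨kerOf (Measure.sum (cpow σ)), ?_⟩
  refine LinearMap.ext fun f => ?_
  have h0 : (kerOf (Measure.sum (cpow σ))).op (f - (kerOf σ).op f) =
      (kerOf (Measure.sum (cpow σ))).op f - (kerOf (Measure.sum (cpow σ))).op ((kerOf σ).op f) :=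
    map_sub _ _ _
  change (kerOf (Measure.sum (cpow σ))).op (f - (kerOf σ).op f) = f
  rw [h0]
  ext x
  change ((kerOf (Measure.sum (cpow σ))).op f : (Fin d → ℝ) → ℝ) x -
    ((kerOf (Measure.sum (cpow σ))).op ((kerOf σ).op f) : (Fin d → ℝ) → ℝ) x =
    (f : (Fin d → ℝ) → ℝ) x
  rw [kerOf_apply, kerOf_apply]
  have h1 := hasSum_integral_measure (SP.integrable_shift (Measure.sum (cpow σ)) f x)
  have h2 := hasSum_integral_measure
    (SP.integrable_shift (Measure.sum (cpow σ)) ((kerOf σ).op f) x)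
  have h3 : ∀ n, ∫ y, (((kerOf σ).op f : SP d) : (Fin d → ℝ) → ℝ) (x + y) ∂(cpow σ n) =
      ∫ y, (f : (Fin d → ℝ) → ℝ) (x + y) ∂(cpow σ (n + 1)) := by
    intro n
    have := (cpow_univ σ n).1
    have hi := SP.integrable_shift (cpow σ (n + 1)) f x
    conv_rhs => unfold cpow
    unfold cpow at hi
    rw [integral_conv hi]
    simp_rw [kerOf_apply, add_assoc]
  simp_rw [h3] at h2
  have h4 := h1.tsum_eq
  rw [h1.summable.tsum_eq_zero_add, h2.tsum_eq] at h4
  rw [← h4]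
  simp [cpow]

/-! ### Planar potentials in polar coordinates -/

/-- embedding of a coordinate plane -/
def emb {d : ℕ} (k j : Fin d) (p : ℝ × ℝ) : Fin d → ℝ := p.1 • Pi.single k 1 + p.2 • Pi.single j 1

theorem emb_cont {d : ℕ} (k j : Fin d) : Continuous (emb k j) := by
  unfold emb; fun_prop

/-- polar coordinates -/
def pcoord (p : ℝ × ℝ) : ℝ × ℝ := (p.1 * Real.cos p.2, p.1 * Real.sin p.2)

theorem pcoord_cont : Continuous pcoord := by
  unfold pcoord; fun_prop

/-- the polar parameter rectangle -/
def pS : Set (ℝ × ℝ) := Set.Ioo 0 2 ×ˢ Set.Ioo (-Real.pi) Real.pi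

theorem pS_meas : MeasurableSet pS := measurableSet_Ioo.prod measurableSet_Ioo

theorem pS_sub : pS ⊆ Set.Icc (0 : ℝ) 2 ×ˢ Set.Icc (-Real.pi) Real.pi :=
  Set.prod_mono Set.Ioo_subset_Icc_self Set.Ioo_subset_Icc_self

theorem pS_compact : IsCompact (Set.Icc (0 : ℝ) 2 ×ˢ Set.Icc (-Real.pi) Real.pi) :=
  isCompact_Icc.prod isCompact_Icc

theorem pS_integrable {H : ℝ × ℝ → ℝ} (hH : Continuous H) : IntegrableOn H pS :=
  (hH.continuousOn.integrableOn_compact pS_compact).mono_set pS_sub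

theorem pS_finite : IsFiniteMeasure (volume.restrict pS) := by
  refine ⟨?_⟩
  rw [Measure.restrict_apply_univ]
  exact (measure_mono pS_sub).trans_lt pS_compact.measure_lt_top

theorem pS_int_theta {H : ℝ × ℝ → ℝ} (hH : Continuous H) :
    ∫ p in pS, H p = ∫ r in Set.Ioo (0 : ℝ) 2, ∫ t in (-Real.pi)..Real.pi, H (r, t) := by
  have h := setIntegral_prod (μ := (volume : Measure ℝ)) (ν := (volume : Measure ℝ)) H
    (pS_integrable hH)
  refine Eq.trans h ?_
  refine setIntegral_congr_fun measurableSet_Ioo fun r _ => ?_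
  rw [intervalIntegral.integral_of_le (by linarith [Real.pi_pos]), integral_Ioc_eq_integral_Ioo]

theorem pS_int_r {H : ℝ × ℝ → ℝ} (hH : Continuous H) :
    ∫ p in pS, H p = ∫ t in Set.Ioo (-Real.pi) Real.pi, ∫ r in (0 : ℝ)..2, H (r, t) := by
  have h0 := pS_integrable hH
  unfold pS at h0
  have h := setIntegral_prod (μ := (volume : Measure ℝ)) (ν := (volume : Measure ℝ)) H h0
  refine Eq.trans h ?_
  rw [integral_integral_swap]
  · refine setIntegral_congr_fun measurableSet_Ioo fun r _ => ?_
    rw [intervalIntegral.integral_of_le (by norm_num), integral_Ioc_eq_integral_Ioo]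
  · rw [Measure.prod_restrict]
    exact h0

/-- kernel operator with polar parametrisation -/
def polarKer {d : ℕ} (k j : Fin d) (w : ℝ × ℝ → ℝ) (hw : Continuous w) : Ker d where
  Om := ℝ × ℝ
  P := volume.restrict pS
  fin := pS_finite
  w := pS.indicator w
  hw := hw.measurable.indicator pS_meas
  bd := by
    obtain ⟨C, hC⟩ := pS_compact.exists_bound_of_continuousOn hw.continuousOn
    refine ⟨max C 0, le_max_right _ _, fun o => ?_⟩
    by_cases ho : o ∈ pS
    · rw [Set.indicator_of_mem ho]
      exact (hC o (pS_sub ho)).trans (le_max_left _ _)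
    · rw [Set.indicator_of_notMem ho]
      simp
  Y := fun p => emb k j (pcoord p)
  hY := ((emb_cont k j).comp pcoord_cont).measurable

theorem polarKer_apply {d : ℕ} (k j : Fin d) (w : ℝ × ℝ → ℝ) (hw : Continuous w) (f : SP d)
    (x : Fin d → ℝ) : ((polarKer k j w hw).op f : (Fin d → ℝ) → ℝ) x =
      ∫ p in pS, w p * (f : (Fin d → ℝ) → ℝ) (x + emb k j (pcoord p)) := by
  rw [Ker.op_apply]
  change ∫ p in pS, pS.indicator w p * (f : (Fin d → ℝ) → ℝ) (x + emb k j (pcoord p)) = _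
  refine setIntegral_congr_fun pS_meas fun p hp => ?_
  simp only [Set.indicator_of_mem hp]

theorem polar_cont {d : ℕ} (k j : Fin d) (f : SP d) (x : Fin d → ℝ) :
    Continuous fun p : ℝ × ℝ => (f : (Fin d → ℝ) → ℝ) (x + emb k j (pcoord p)) :=
  (SP.cont f).comp (continuous_const.add ((emb_cont k j).comp pcoord_cont))

theorem polar_deriv_r {d : ℕ} (k j : Fin d) (f : SP d) (x : Fin d → ℝ) (t r : ℝ) :
    HasDerivAt (fun r : ℝ => (f : (Fin d → ℝ) → ℝ) (x + emb k j (pcoord (r, t))))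
      (Real.cos t * pd k (f : (Fin d → ℝ) → ℝ) (x + emb k j (pcoord (r, t))) +
        Real.sin t * pd j (f : (Fin d → ℝ) → ℝ) (x + emb k j (pcoord (r, t)))) r := by
  have h1 : HasDerivAt (fun r : ℝ => x + emb k j (pcoord (r, t)))
      (Real.cos t • Pi.single k (1 : ℝ) + Real.sin t • Pi.single j (1 : ℝ)) r := by
    unfold emb pcoord
    have a := ((hasDerivAt_id r).mul_const (Real.cos t)).smul_const (Pi.single k 1 : Fin d → ℝ)
    have b := ((hasDerivAt_id r).mul_const (Real.sin t)).smul_const (Pi.single j 1 : Fin d → ℝ)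
    simpa using (a.add b).const_add x
  have h := ((SP.diff f) (x + emb k j (pcoord (r, t)))).hasFDerivAt.comp_hasDerivAt r h1
  refine h.congr_deriv ?_
  rw [map_add, map_smul, map_smul]
  rfl

theorem polar_deriv_t {d : ℕ} (k j : Fin d) (f : SP d) (x : Fin d → ℝ) (r t : ℝ) :
    HasDerivAt (fun t : ℝ => (f : (Fin d → ℝ) → ℝ) (x + emb k j (pcoord (r, t))))
      (r * (Real.cos t * pd j (f : (Fin d → ℝ) → ℝ) (x + emb k j (pcoord (r, t))) -
        Real.sin t * pd k (f : (Fin d → ℝ) → ℝ) (x + emb k j (pcoord (r, t))))) t := by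
  have h1 : HasDerivAt (fun t : ℝ => x + emb k j (pcoord (r, t)))
      ((r * -Real.sin t) • Pi.single k (1 : ℝ) + (r * Real.cos t) • Pi.single j (1 : ℝ)) t := by
    unfold emb pcoord
    have a := ((Real.hasDerivAt_cos t).const_mul r).smul_const (Pi.single k 1 : Fin d → ℝ)
    have b := ((Real.hasDerivAt_sin t).const_mul r).smul_const (Pi.single j 1 : Fin d → ℝ)
    exact (a.add b).const_add x
  have h := ((SP.diff f) (x + emb k j (pcoord (r, t)))).hasFDerivAt.comp_hasDerivAt t h1
  refine h.congr_deriv ?_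
  rw [map_add, map_smul, map_smul]
  simp only [pd, smul_eq_mul]
  ring

/-- first potential -/
def A1 {d : ℕ} (k j : Fin d) : Ker d :=
  polarKer k j (fun p => -(1 - p.1 ^ 2 / 4) * Real.cos p.2 / (2 * Real.pi)) (by fun_prop)
/-- second potential -/
def A2 {d : ℕ} (k j : Fin d) : Ker d :=
  polarKer k j (fun p => -(1 - p.1 ^ 2 / 4) * Real.sin p.2 / (2 * Real.pi)) (by fun_prop)
/-- remainder -/
def Rr {d : ℕ} (k j : Fin d) : Ker d :=
  polarKer k j (fun p => p.1 / (4 * Real.pi)) (by fun_prop)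

theorem D_ker {d : ℕ} (K : Ker d) (j : Fin d) (f : SP d) : Dop j (K.op f) = K.op (Dop j f) :=
  LinearMap.congr_fun (K.commute_D j).eq f

theorem polar_P1 {d : ℕ} (k j : Fin d) (f : SP d) :
    Dop k ((A1 k j).op f) + Dop j ((A2 k j).op f) + (Rr k j).op f = f := by
  rw [D_ker, D_ker]
  ext x
  change ((A1 k j).op (Dop k f) : (Fin d → ℝ) → ℝ) x + ((A2 k j).op (Dop j f) : (Fin d → ℝ) → ℝ) x
    + ((Rr k j).op f : (Fin d → ℝ) → ℝ) x = _
  unfold A1 A2 Rr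
  rw [polarKer_apply, polarKer_apply, polarKer_apply]
  have c1 := polar_cont k j (Dop k f) x
  have c2 := polar_cont k j (Dop j f) x
  have c3 := polar_cont k j f x
  have C1 : Continuous fun p : ℝ × ℝ => -(1 - p.1 ^ 2 / 4) * Real.cos p.2 / (2 * Real.pi) *
      (Dop k f : (Fin d → ℝ) → ℝ) (x + emb k j (pcoord p)) := Continuous.mul (by fun_prop) c1
  have C2 : Continuous fun p : ℝ × ℝ => -(1 - p.1 ^ 2 / 4) * Real.sin p.2 / (2 * Real.pi) *
      (Dop j f : (Fin d → ℝ) → ℝ) (x + emb k j (pcoord p)) := Continuous.mul (by fun_prop) c2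
  have C3 : Continuous fun p : ℝ × ℝ => p.1 / (4 * Real.pi) *
      (f : (Fin d → ℝ) → ℝ) (x + emb k j (pcoord p)) := Continuous.mul (by fun_prop) c3
  rw [← integral_add (pS_integrable C1) (pS_integrable C2),
    ← integral_add (pS_integrable (C1.fun_add C2)) (pS_integrable C3),
    pS_int_r ((C1.fun_add C2).fun_add C3)]
  have key : ∀ t : ℝ, ∫ r in (0 : ℝ)..2, (-(1 - r ^ 2 / 4) * Real.cos t / (2 * Real.pi) *
        (Dop k f : (Fin d → ℝ) → ℝ) (x + emb k j (pcoord (r, t))) +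
      -(1 - r ^ 2 / 4) * Real.sin t / (2 * Real.pi) *
        (Dop j f : (Fin d → ℝ) → ℝ) (x + emb k j (pcoord (r, t))) +
      r / (4 * Real.pi) * (f : (Fin d → ℝ) → ℝ) (x + emb k j (pcoord (r, t)))) =
      (f : (Fin d → ℝ) → ℝ) x / (2 * Real.pi) := by
    intro t
    have hd : ∀ r ∈ Set.uIcc (0 : ℝ) 2, HasDerivAt (fun r : ℝ => -(1 - r ^ 2 / 4) / (2 * Real.pi) *
        (f : (Fin d → ℝ) → ℝ) (x + emb k j (pcoord (r, t))))
        (-(1 - r ^ 2 / 4) * Real.cos t / (2 * Real.pi) *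
        (Dop k f : (Fin d → ℝ) → ℝ) (x + emb k j (pcoord (r, t))) +
      -(1 - r ^ 2 / 4) * Real.sin t / (2 * Real.pi) *
        (Dop j f : (Fin d → ℝ) → ℝ) (x + emb k j (pcoord (r, t))) +
      r / (4 * Real.pi) * (f : (Fin d → ℝ) → ℝ) (x + emb k j (pcoord (r, t)))) r := by
      intro r _
      have hg : HasDerivAt (fun r : ℝ => -(1 - r ^ 2 / 4) / (2 * Real.pi)) (r / (4 * Real.pi)) r := by
        have := ((((hasDerivAt_id r).pow 2).div_const 4).const_sub 1).neg.div_const (2 * Real.pi)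
        refine this.congr_deriv ?_
        simp only [id, Nat.cast_ofNat, Nat.add_one_sub_one, pow_one, mul_one]
        field_simp
      refine (hg.mul (polar_deriv_r k j f x t r)).congr_deriv ?_
      rw [Dop_apply, Dop_apply]
      ring
    rw [intervalIntegral.integral_eq_sub_of_hasDerivAt hd]
    · have e0 : emb k j (pcoord (0, t)) = 0 := by simp [emb, pcoord]
      rw [e0]
      norm_num
      ring
    · refine Continuous.intervalIntegrable ?_ _ _
      have hpr : Continuous fun r : ℝ => (r, t) := by fun_prop
      have hcc := Continuous.comp ((C1.fun_add C2).fun_add C3) hpr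
      simp only [Function.comp_def] at hcc
      exact hcc
  simp only [key]
  have := Real.pi_pos
  rw [setIntegral_const, measureReal_def, Real.volume_Ioo, ENNReal.toReal_ofReal (by linarith)]
  simp only [smul_eq_mul]
  field_simp
  ring

theorem polar_P2 {d : ℕ} (k j : Fin d) (f : SP d) :
    Dop j ((A1 k j).op f) = Dop k ((A2 k j).op f) := by
  rw [D_ker, D_ker]
  ext x
  unfold A1 A2
  rw [polarKer_apply, polarKer_apply]
  have c1 := polar_cont k j (Dop k f) x
  have c2 := polar_cont k j (Dop j f) x
  rw [← sub_eq_zero, ← integral_sub (pS_integrable (by fun_prop)) (pS_integrable (by fun_prop)),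
    pS_int_theta (by fun_prop)]
  refine setIntegral_eq_zero_of_forall_eq_zero fun r hr => ?_
  have hd := fun t (_ : t ∈ Set.uIcc (-Real.pi) Real.pi) => polar_deriv_t k j f x r t
  have h := intervalIntegral.integral_eq_sub_of_hasDerivAt hd ?_
  · have e0 : pcoord (r, Real.pi) = pcoord (r, -Real.pi) := by simp [pcoord]
    rw [e0, sub_self, intervalIntegral.integral_const_mul] at h
    have h' := (mul_eq_zero.1 h).resolve_left hr.1.ne'
    have : ∀ t, -(1 - r ^ 2 / 4) * Real.cos t / (2 * Real.pi) *
        (Dop j f : (Fin d → ℝ) → ℝ) (x + emb k j (pcoord (r, t))) -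
      -(1 - r ^ 2 / 4) * Real.sin t / (2 * Real.pi) *
        (Dop k f : (Fin d → ℝ) → ℝ) (x + emb k j (pcoord (r, t))) =
      -(1 - r ^ 2 / 4) / (2 * Real.pi) *
      (Real.cos t * pd j (f : (Fin d → ℝ) → ℝ) (x + emb k j (pcoord (r, t))) -
        Real.sin t * pd k (f : (Fin d → ℝ) → ℝ) (x + emb k j (pcoord (r, t)))) := by
      intro t
      rw [Dop_apply, Dop_apply]
      ring
    simp only [this]
    rw [intervalIntegral.integral_const_mul, h', mul_zero]
  · refine Continuous.intervalIntegrable ?_ _ _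
    have a1 := c1.comp ((continuous_const (y := r)).prodMk continuous_id)
    have a2 := c2.comp ((continuous_const (y := r)).prodMk continuous_id)
    simp only [Function.comp_def, id, Dop_apply] at *
    fun_prop

/-- disk of radius two -/
def disk : Set (ℝ × ℝ) := {y | y.1 ^ 2 + y.2 ^ 2 < 4}

theorem disk_meas : MeasurableSet disk :=
  (isOpen_lt (by fun_prop) continuous_const).measurableSet

theorem disk_sub : disk ⊆ Set.Icc (-2 : ℝ) 2 ×ˢ Set.Icc (-2 : ℝ) 2 := by
  intro y hy
  have hy' : y.1 ^ 2 + y.2 ^ 2 < 4 := hy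
  refine ⟨⟨?_, ?_⟩, ⟨?_, ?_⟩⟩ <;> nlinarith [sq_nonneg y.1, sq_nonneg y.2]

theorem disk_lt_top : (volume : Measure (ℝ × ℝ)) disk < ∞ :=
  (measure_mono disk_sub).trans_lt (isCompact_Icc.prod isCompact_Icc).measure_lt_top

theorem disk_integrable {H : ℝ × ℝ → ℝ} (hH : Continuous H) : IntegrableOn H disk :=
  (hH.continuousOn.integrableOn_compact (isCompact_Icc.prod isCompact_Icc)).mono_set disk_sub

theorem Rr_disk {d : ℕ} (k j : Fin d) (f : SP d) (x : Fin d → ℝ) :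
    ((Rr k j).op f : (Fin d → ℝ) → ℝ) x =
      1 / (4 * Real.pi) * ∫ y in disk, (f : (Fin d → ℝ) → ℝ) (x + emb k j y) := by
  unfold Rr
  rw [polarKer_apply]
  rw [← integral_indicator disk_meas, ← integral_comp_polarCoord_symm, ← integral_const_mul]
  have ht : polarCoord.target ∩ (Set.Iio (2 : ℝ) ×ˢ Set.univ) = pS := by
    ext p
    simp [pS, polarCoord]
    tauto
  rw [← ht, ← setIntegral_indicator (measurableSet_Iio.prod MeasurableSet.univ)]
  refine setIntegral_congr_fun polarCoord.open_target.measurableSet fun p hp => ?_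
  have hp0 : 0 < p.1 := hp.1
  have hs : polarCoord.symm p = pcoord p := rfl
  have hiff : pcoord p ∈ disk ↔ p ∈ Set.Iio (2 : ℝ) ×ˢ (Set.univ : Set ℝ) := by
    have : (p.1 * Real.cos p.2) ^ 2 + (p.1 * Real.sin p.2) ^ 2 = p.1 ^ 2 := by
      rw [mul_pow, mul_pow, ← mul_add, Real.cos_sq_add_sin_sq, mul_one]
    simp only [disk, pcoord, Set.mem_ofPred_eq, this, Set.mem_prod, Set.mem_Iio, Set.mem_univ,
      and_true]
    constructor <;> intro h <;> nlinarith
  simp only [hs]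
  by_cases h : p ∈ Set.Iio (2 : ℝ) ×ˢ (Set.univ : Set ℝ)
  · rw [Set.indicator_of_mem h, Set.indicator_of_mem (hiff.2 h), smul_eq_mul]
    ring
  · rw [Set.indicator_of_notMem h, Set.indicator_of_notMem (fun h' => h (hiff.1 h'))]
    simp

theorem disk_vol {d : ℕ} (k : Fin d) : volume.real disk = 4 * Real.pi := by
  have h := polar_P1 k k (1 : SP d)
  have h1 : ∀ K : Ker d, Dop k (K.op 1) = 0 := by
    intro K
    have : Dop k (1 : SP d) = 0 := by
      ext x
      rw [Dop_apply]
      change fderiv ℝ (fun _ : Fin d → ℝ => (1 : ℝ)) x (Pi.single k 1) = 0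
      simp
    rw [D_ker, this, map_zero]
  rw [h1, h1, zero_add, zero_add] at h
  have h2 := Rr_disk k k (1 : SP d) 0
  rw [h] at h2
  change (1 : ℝ) = 1 / (4 * Real.pi) * ∫ y in disk, (1 : ℝ) at h2
  have := Real.pi_pos
  rw [setIntegral_const, smul_eq_mul, mul_one] at h2
  field_simp at h2
  linarith

/-- unit square -/
def square : Set (ℝ × ℝ) := Set.Ioc 0 1 ×ˢ Set.Ioc 0 1

theorem square_sub : square ⊆ disk := by
  rintro y ⟨⟨h1, h2⟩, ⟨h3, h4⟩⟩
  change y.1 ^ 2 + y.2 ^ 2 < 4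
  nlinarith

theorem square_meas : MeasurableSet square := measurableSet_Ioc.prod measurableSet_Ioc

theorem square_vol : volume.real square = 1 := by
  rw [measureReal_def]
  unfold square
  rw [Measure.volume_eq_prod, Measure.prod_prod]
  simp

theorem square_avg {d : ℕ} (k j : Fin d) (f : SP d) (x : Fin d → ℝ) :
    ∫ y in square, (f : (Fin d → ℝ) → ℝ) (x + emb k j y) =
      ((avg k).op ((avg j).op f) : (Fin d → ℝ) → ℝ) x := by
  have hi : IntegrableOn (fun y => (f : (Fin d → ℝ) → ℝ) (x + emb k j y)) square :=
    (disk_integrable ((SP.cont f).comp (continuous_const.add (emb_cont k j)))).mono_set square_sub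
  have h := setIntegral_prod (μ := (volume : Measure ℝ)) (ν := (volume : Measure ℝ)) _ hi
  refine Eq.trans h ?_
  rw [avg_apply]
  refine setIntegral_congr_fun measurableSet_Ioc fun s _ => ?_
  rw [avg_apply]
  refine setIntegral_congr_fun measurableSet_Ioc fun t _ => ?_
  simp only [emb]
  rw [single_eq_smul k s, single_eq_smul j t, add_assoc]

/-- the remaining measure -/
def sig {d : ℕ} (k j : Fin d) : Measure (Fin d → ℝ) :=
  ENNReal.ofReal (1 / (4 * Real.pi)) • (volume.restrict (disk \ square)).map (emb k j)

theorem sig_univ {d : ℕ} (k j : Fin d) : sig k j Set.univ < 1 := by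
  have hpi := Real.pi_gt_three
  unfold sig
  rw [Measure.smul_apply, Measure.map_apply (emb_cont k j).measurable MeasurableSet.univ,
    Set.preimage_univ, Measure.restrict_apply_univ, smul_eq_mul]
  have hlt : (volume : Measure (ℝ × ℝ)) (disk \ square) < ∞ :=
    (measure_mono Set.sdiff_subset).trans_lt disk_lt_top
  have hr : volume.real (disk \ square) = 4 * Real.pi - 1 := by
    rw [measureReal_sdiff square_sub square_meas disk_lt_top.ne,
      disk_vol k, square_vol]
  rw [← ENNReal.ofReal_toReal hlt.ne, ← measureReal_def, hr,
    ← ENNReal.ofReal_mul (by positivity), ENNReal.ofReal_lt_one, ← lt_div_iff₀' (by positivity)]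
  simp

theorem planar {d : ℕ} (k j : Fin d) : ∃ G1 G2 : Module.End ℝ (SP d), Bnd G1 ∧ Bnd G2 ∧
    (∀ f, Dop j (G1 f) = Dop k (G2 f)) ∧
    (∀ f, ((avg k).op f = 0 ∨ (avg j).op f = 0) → Dop k (G1 f) + Dop j (G2 f) = f) := by
  have hfin : IsFiniteMeasure (sig k j) := ⟨(sig_univ k j).trans ENNReal.one_lt_top⟩
  obtain ⟨N, hN⟩ := neumann (sig k j) (sig_univ k j)
  refine ⟨(A1 k j).op * N.op, (A2 k j).op * N.op, (Ker.bnd _).mul (Ker.bnd _),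
    (Ker.bnd _).mul (Ker.bnd _), fun f => polar_P2 k j _, fun f hf => ?_⟩
  change Dop k ((A1 k j).op (N.op f)) + Dop j ((A2 k j).op (N.op f)) = f
  have h1 := polar_P1 k j (N.op f)
  have hR : ∀ g : SP d, (Rr k j).op g =
      (1 / (4 * Real.pi)) • (avg k).op ((avg j).op g) + (kerOf (sig k j)).op g := by
    intro g
    ext x
    change _ = (1 / (4 * Real.pi)) * ((avg k).op ((avg j).op g) : (Fin d → ℝ) → ℝ) x +
      ((kerOf (sig k j)).op g : (Fin d → ℝ) → ℝ) x
    have hi := disk_integrable ((SP.cont g).comp (continuous_const (y := x) |>.add (emb_cont k j)))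
    rw [Rr_disk, kerOf_apply, ← square_avg]
    unfold sig
    rw [integral_smul_measure, integral_map (f := fun y => (g : (Fin d → ℝ) → ℝ) (x + y)) (emb_cont k j).aemeasurable
      ((SP.cont g).comp (continuous_const.add continuous_id)).aestronglyMeasurable,
      ENNReal.toReal_ofReal (by have := Real.pi_pos; positivity), smul_eq_mul, ← mul_add]
    congr 1
    have h2 := integral_inter_add_sdiff₀ square_meas.nullMeasurableSet hi
    rw [Set.inter_eq_self_of_subset_right square_sub] at h2
    exact h2.symm
  have hz : (avg k).op ((avg j).op (N.op f)) = 0 := by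
    have a1 : (avg j).op (N.op f) = N.op ((avg j).op f) :=
      LinearMap.congr_fun ((avg j).commute N).eq f
    have a2 : ∀ g, (avg k).op (N.op g) = N.op ((avg k).op g) :=
      fun g => LinearMap.congr_fun ((avg k).commute N).eq g
    have a3 : (avg k).op ((avg j).op f) = (avg j).op ((avg k).op f) :=
      LinearMap.congr_fun ((avg k).commute (avg j)).eq f
    rw [a1, a2]
    rcases hf with hf | hf
    · rw [a3, hf, map_zero, map_zero]
    · rw [hf, map_zero, map_zero]
  have hs : (kerOf (sig k j)).op (N.op f) = N.op ((kerOf (sig k j)).op f) :=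
    LinearMap.congr_fun ((kerOf (sig k j)).commute N).eq f
  have hNf : N.op f - N.op ((kerOf (sig k j)).op f) = f := by
    have h := LinearMap.congr_fun hN f
    have h' : N.op (f - (kerOf (sig k j)).op f) = f := h
    rwa [map_sub] at h'
  rw [hR, hz, smul_zero, zero_add, hs] at h1
  rw [← hNf]
  rw [eq_sub_iff_add_eq]
  rw [hNf]
  exact h1

/-! ### Symmetric trace-free anti-divergence -/

/-- Kronecker symbol -/
def kd {d : ℕ} (a b : Fin d) : ℝ := if a = b then 1 else 0

theorem sum_kd {d : ℕ} (k : Fin d) (F : Fin d → SP d) : ∑ b, kd b k • F b = F k := by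
  rw [Finset.sum_eq_single k]
  · simp [kd]
  · intro b _ hb
    simp [kd, hb]
  · simp

/-- planar stress block -/
def blk {d : ℕ} (k j a b : Fin d) (u w : SP d) : SP d :=
  (kd a k * kd b k - kd a j * kd b j) • u + (kd a k * kd b j + kd a j * kd b k) • w

theorem blk_symm {d : ℕ} (k j a b : Fin d) (u w : SP d) : blk k j a b u w = blk k j b a u w := by
  unfold blk
  rw [mul_comm (kd a k) (kd b k), mul_comm (kd a j) (kd b j), mul_comm (kd a k) (kd b j),
    mul_comm (kd a j) (kd b k), add_comm (kd b j * kd a k)]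

theorem blk_trace {d : ℕ} (k j : Fin d) (hkj : k ≠ j) (u w : SP d) :
    ∑ a, blk k j a a u w = 0 := by
  unfold blk
  rw [Finset.sum_add_distrib, ← Finset.sum_smul, ← Finset.sum_smul]
  have h1 : ∑ a, (kd a k * kd a k - kd a j * kd a j) = 0 := by
    simp [kd]
  have h2 : ∑ a, (kd a k * kd a j + kd a j * kd a k) = 0 := by
    refine Finset.sum_eq_zero fun a _ => ?_
    unfold kd
    by_cases h : a = k
    · subst h; simp [hkj]
    · simp [h]
  rw [h1, h2, zero_smul, zero_smul, add_zero]

theorem blk_div {d : ℕ} (k j a : Fin d) (u w g : SP d) (h1 : Dop j u = Dop k w)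
    (h2 : Dop k u + Dop j w = g) : ∑ b, Dop b (blk k j a b u w) = kd a k • g := by
  have h : ∀ b, Dop b (blk k j a b u w) =
      (kd a k • kd b k • Dop b u - kd a j • kd b j • Dop b u) +
      (kd a k • kd b j • Dop b w + kd a j • kd b k • Dop b w) := by
    intro b
    unfold blk
    rw [map_add, map_smul, map_smul, sub_smul, add_smul, mul_smul, mul_smul, mul_smul, mul_smul]
  simp_rw [h]
  rw [Finset.sum_add_distrib, Finset.sum_sub_distrib, Finset.sum_add_distrib,
    ← Finset.smul_sum, ← Finset.smul_sum, ← Finset.smul_sum, ← Finset.smul_sum,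
    sum_kd k (fun b => Dop b u), sum_kd j (fun b => Dop b u),
    sum_kd j (fun b => Dop b w), sum_kd k (fun b => Dop b w), h1, ← h2, smul_add]
  abel

theorem antidiv (d : ℕ) (hd : 2 ≤ d) : ∃ R : Fin d → Fin d → Fin d → Module.End ℝ (SP d),
    (∀ a b k, Bnd (R a b k)) ∧ (∀ a b k, R a b k = R b a k) ∧
    (∀ k f, ∑ a, R a a k f = 0) ∧
    (∀ a k f, ∑ b, Dop b (R a b k f) = kd a k • (f - PartAvg d d f)) := by
  have hne : ∀ k : Fin d, ∃ j : Fin d, k ≠ j := by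
    intro k
    have : Nontrivial (Fin d) := Fin.nontrivial_iff_two_le.2 hd
    obtain ⟨j, hj⟩ := exists_ne k
    exact ⟨j, hj.symm⟩
  have hjj : ∀ k i : Fin d, ∃ j : Fin d, k ≠ j ∧ (i = k ∨ i = j) := by
    intro k i
    by_cases h : i = k
    · obtain ⟨j, hj⟩ := hne k
      exact ⟨j, hj, Or.inl h⟩
    · exact ⟨i, fun h' => h h'.symm, Or.inr rfl⟩
  choose jj hj1 hj2 using hjj
  choose G1 G2 b1 b2 e1 e2 using fun k j : Fin d => planar k j
  let R : Fin d → Fin d → Fin d → Module.End ℝ (SP d) := fun a b k =>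
    ∑ i, ((kd a k * kd b k - kd a (jj k i) * kd b (jj k i)) • (G1 k (jj k i) * Qop i) +
      (kd a k * kd b (jj k i) + kd a (jj k i) * kd b k) • (G2 k (jj k i) * Qop i))
  have hR : ∀ a b k f, R a b k f =
      ∑ i, blk k (jj k i) a b (G1 k (jj k i) (Qop i f)) (G2 k (jj k i) (Qop i f)) := by
    intro a b k f
    simp only [R]
    rw [LinearMap.sum_apply]
    rfl
  refine ⟨R, fun a b k => ?_, fun a b k => ?_, fun k f => ?_, fun a k f => ?_⟩
  · refine Bnd.sum _ fun i _ => ?_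
    exact (((b1 _ _).mul (Q_bnd i)).smul _).add (((b2 _ _).mul (Q_bnd i)).smul _)
  · refine LinearMap.ext fun f => ?_
    rw [hR, hR]
    exact Finset.sum_congr rfl fun i _ => blk_symm _ _ _ _ _ _
  · simp_rw [hR]
    rw [Finset.sum_comm]
    exact Finset.sum_eq_zero fun i _ => blk_trace _ _ (hj1 k i) _ _
  · simp_rw [hR, map_sum]
    rw [Finset.sum_comm, ← Q_sum, Finset.smul_sum]
    refine Finset.sum_congr rfl fun i _ => ?_
    refine blk_div _ _ _ _ _ _ (e1 _ _ _) (e2 _ _ _ ?_)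
    have hq : (avg i).op (Qop i f) = 0 := LinearMap.congr_fun (Q_avg i) f
    rcases hj2 k i with h | h
    · left; rw [← h]; exact hq
    · right; rw [← h]; exact hq

/-! ### The bilinear operator -/

/-- family of operators indexed by three indices -/
abbrev RFam (d : ℕ) := Fin d → Fin d → Fin d → Module.End ℝ (SP d)

/-- the commutator term -/
def Hf {d : ℕ} (R : RFam d) (v : Fin d → SP d) (M : Fin d → Fin d → SP d) (k : Fin d) : SP d :=
  ∑ l, ∑ m, ∑ q, Dop m (v l) * R k m q (M q l)

/-- the bilinear operator on components -/
def Bf {d : ℕ} (R : RFam d) (v : Fin d → SP d) (M : Fin d → Fin d → SP d) (a b : Fin d) : SP d :=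
  ∑ l, ∑ k, v l * R a b k (M k l) - ∑ k, R a b k (Hf R v M k)

theorem Hf_add_left {d : ℕ} (R : RFam d) (v v' : Fin d → SP d) (M : Fin d → Fin d → SP d)
    (k : Fin d) : Hf R (v + v') M k = Hf R v M k + Hf R v' M k := by
  unfold Hf
  simp only [Pi.add_apply, map_add, add_mul, Finset.sum_add_distrib]

theorem Hf_smul_left {d : ℕ} (R : RFam d) (c : ℝ) (v : Fin d → SP d) (M : Fin d → Fin d → SP d)
    (k : Fin d) : Hf R (c • v) M k = c • Hf R v M k := by
  unfold Hf
  simp only [Pi.smul_apply, map_smul, smul_mul_assoc, Finset.smul_sum]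

theorem Hf_add_right {d : ℕ} (R : RFam d) (v : Fin d → SP d) (M M' : Fin d → Fin d → SP d)
    (k : Fin d) : Hf R v (M + M') k = Hf R v M k + Hf R v M' k := by
  unfold Hf
  simp only [Pi.add_apply, map_add, mul_add, Finset.sum_add_distrib]

theorem Hf_smul_right {d : ℕ} (R : RFam d) (c : ℝ) (v : Fin d → SP d) (M : Fin d → Fin d → SP d)
    (k : Fin d) : Hf R v (c • M) k = c • Hf R v M k := by
  unfold Hf
  simp only [Pi.smul_apply, map_smul, mul_smul_comm, Finset.smul_sum]

theorem Bf_add_left {d : ℕ} (R : RFam d) (v v' : Fin d → SP d) (M : Fin d → Fin d → SP d)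
    (a b : Fin d) : Bf R (v + v') M a b = Bf R v M a b + Bf R v' M a b := by
  unfold Bf
  simp only [Hf_add_left, Pi.add_apply, map_add, add_mul, Finset.sum_add_distrib]
  abel

theorem Bf_smul_left {d : ℕ} (R : RFam d) (c : ℝ) (v : Fin d → SP d) (M : Fin d → Fin d → SP d)
    (a b : Fin d) : Bf R (c • v) M a b = c • Bf R v M a b := by
  unfold Bf
  simp only [Hf_smul_left, Pi.smul_apply, map_smul, smul_mul_assoc, Finset.smul_sum, smul_sub]

theorem Bf_add_right {d : ℕ} (R : RFam d) (v : Fin d → SP d) (M M' : Fin d → Fin d → SP d)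
    (a b : Fin d) : Bf R v (M + M') a b = Bf R v M a b + Bf R v M' a b := by
  unfold Bf
  simp only [Hf_add_right, Pi.add_apply, map_add, mul_add, Finset.sum_add_distrib]
  abel

theorem Bf_smul_right {d : ℕ} (R : RFam d) (c : ℝ) (v : Fin d → SP d) (M : Fin d → Fin d → SP d)
    (a b : Fin d) : Bf R v (c • M) a b = c • Bf R v M a b := by
  unfold Bf
  simp only [Hf_smul_right, Pi.smul_apply, map_smul, mul_smul_comm, Finset.smul_sum, smul_sub]

theorem Bf_symm {d : ℕ} (R : RFam d) (hR : ∀ a b k, R a b k = R b a k) (v : Fin d → SP d)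
    (M : Fin d → Fin d → SP d) (a b : Fin d) : Bf R v M a b = Bf R v M b a := by
  unfold Bf
  simp only [hR a b]

theorem Bf_trace {d : ℕ} (R : RFam d) (hR : ∀ k f, ∑ a, R a a k f = 0) (v : Fin d → SP d)
    (M : Fin d → Fin d → SP d) : ∑ a, Bf R v M a a = 0 := by
  unfold Bf
  rw [Finset.sum_sub_distrib, Finset.sum_comm]
  have h1 : ∀ l, ∑ a, ∑ k, v l * R a a k (M k l) = 0 := by
    intro l
    rw [Finset.sum_comm]
    refine Finset.sum_eq_zero fun k _ => ?_
    rw [← Finset.mul_sum, hR, mul_zero]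
  rw [Finset.sum_eq_zero fun l _ => h1 l]
  have h2 : ∑ a, ∑ k, R a a k (Hf R v M k) = 0 := by
    rw [Finset.sum_comm]
    exact Finset.sum_eq_zero fun k _ => hR k _
  rw [h2, sub_zero]

theorem Bf_div {d : ℕ} (R : RFam d)
    (hR : ∀ a k f, ∑ b, Dop b (R a b k f) = kd a k • (f - PartAvg d d f))
    (v : Fin d → SP d) (M : Fin d → Fin d → SP d) (hM : ∀ k l, PartAvg d d (M k l) = 0)
    (a : Fin d) : ∑ b, Dop b (Bf R v M a b) =
      ∑ l, v l * M a l - PartAvg d d (∑ l, v l * M a l) := by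
  have kds : ∀ F : Fin d → SP d, ∑ k, kd a k • F k = F a := by
    intro F
    rw [← sum_kd a F]
    refine Finset.sum_congr rfl fun k _ => ?_
    simp only [kd, eq_comm]
  have h1 : ∑ b, Dop b (∑ l, ∑ k, v l * R a b k (M k l)) = Hf R v M a + ∑ l, v l * M a l := by
    simp only [map_sum, Dop_mul, Finset.sum_add_distrib]
    congr 1
    · unfold Hf
      rw [Finset.sum_comm]
    · rw [Finset.sum_comm]
      refine Finset.sum_congr rfl fun l _ => ?_
      rw [Finset.sum_comm]
      simp only [← Finset.mul_sum, hR, hM, sub_zero]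
      rw [kds]
  have h2 : ∑ b, Dop b (∑ k, R a b k (Hf R v M k)) = Hf R v M a - PartAvg d d (Hf R v M a) := by
    simp only [map_sum]
    rw [Finset.sum_comm]
    simp only [hR]
    exact kds _
  have h3 : PartAvg d d (Hf R v M a + ∑ l, v l * M a l) = 0 := by
    rw [← h1, map_sum]
    exact Finset.sum_eq_zero fun b _ => PartAvg_D b _
  unfold Bf
  simp only [map_sub]
  rw [Finset.sum_sub_distrib, h1, h2]
  rw [map_add] at h3
  rw [eq_neg_of_add_eq_zero_left h3]
  abel

theorem eLp_sum {d : ℕ} {ι : Type*} (s : Finset ι) (F : ι → SP d) {p : ℝ≥0∞} (hp : 1 ≤ p)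
    (X : ℝ≥0∞) (h : ∀ i ∈ s, eLpNorm (F i : (Fin d → ℝ) → ℝ) p (volume.restrict (cube d)) ≤ X) :
    eLpNorm ((∑ i ∈ s, F i : SP d) : (Fin d → ℝ) → ℝ) p (volume.restrict (cube d)) ≤
      s.card * X := by
  have e : ((∑ i ∈ s, F i : SP d) : (Fin d → ℝ) → ℝ) = ∑ i ∈ s, (F i : (Fin d → ℝ) → ℝ) :=
    map_sum (SP d).val F s
  rw [e]
  refine (eLpNorm_sum_le (fun i _ => SP.aesm (F i) _) hp).trans ?_
  refine (Finset.sum_le_card_nsmul _ _ _ h).trans ?_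
  rw [nsmul_eq_mul]

theorem eLp_mul {d : ℕ} (f g : SP d) (N : ℝ) (hN : ∀ x, ‖(f : (Fin d → ℝ) → ℝ) x‖ ≤ N)
    (p : ℝ≥0∞) : eLpNorm ((f * g : SP d) : (Fin d → ℝ) → ℝ) p (volume.restrict (cube d)) ≤
      ENNReal.ofReal N * eLpNorm (g : (Fin d → ℝ) → ℝ) p (volume.restrict (cube d)) := by
  refine eLpNorm_le_mul_eLpNorm_of_ae_le_mul (Filter.Eventually.of_forall fun x => ?_) p
  change ‖(f : (Fin d → ℝ) → ℝ) x * (g : (Fin d → ℝ) → ℝ) x‖ ≤ _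
  rw [norm_mul]
  exact mul_le_mul_of_nonneg_right (hN x) (norm_nonneg _)

theorem R_unif {d : ℕ} (R : RFam d) (hR : ∀ a b k, Bnd (R a b k)) :
    ∃ K : ℝ≥0∞, K ≠ ∞ ∧ ∀ a b k, ∀ p : ℝ≥0∞, 1 ≤ p → ∀ f : SP d,
      eLpNorm (R a b k f : (Fin d → ℝ) → ℝ) p (volume.restrict (cube d)) ≤
        K * eLpNorm (f : (Fin d → ℝ) → ℝ) p (volume.restrict (cube d)) := by
  choose C hC0 hC using hR
  refine ⟨∑ a, ∑ b, ∑ k, ENNReal.ofReal (C a b k), ?_, fun a b k p hp f => ?_⟩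
  · simp [ENNReal.sum_eq_top]
  · refine (hC a b k p hp f).trans (mul_le_mul_left ?_ _)
    refine le_trans ?_ (Finset.single_le_sum (fun _ _ => zero_le) (Finset.mem_univ a))
    refine le_trans ?_ (Finset.single_le_sum (fun _ _ => zero_le) (Finset.mem_univ b))
    exact Finset.single_le_sum (f := fun k => ENNReal.ofReal (C a b k))
      (fun _ _ => zero_le) (Finset.mem_univ k)

theorem Bf_bound {d : ℕ} (R : RFam d) (hR : ∀ a b k, Bnd (R a b k)) :
    ∃ K : ℝ≥0∞, K ≠ ∞ ∧ ∀ p : ℝ≥0∞, 1 ≤ p → ∀ (v : Fin d → SP d) (M : Fin d → Fin d → SP d)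
      (N : ℝ) (X : ℝ≥0∞), (∀ l x, ‖(v l : (Fin d → ℝ) → ℝ) x‖ ≤ N) →
      (∀ m l x, ‖(Dop m (v l) : (Fin d → ℝ) → ℝ) x‖ ≤ N) →
      (∀ k l, eLpNorm (M k l : (Fin d → ℝ) → ℝ) p (volume.restrict (cube d)) ≤ X) →
      ∀ a b, eLpNorm (Bf R v M a b : (Fin d → ℝ) → ℝ) p (volume.restrict (cube d)) ≤
        K * (ENNReal.ofReal N * X) := by
  obtain ⟨K, hK, hKR⟩ := R_unif R hR
  refine ⟨d * (d * K) + d * (K * (d * (d * (d * K)))), ?_, ?_⟩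
  · finiteness
  · intro p hp v M N X hv hdv hM a b
    have hprod : ∀ (f : SP d), (∀ x, ‖(f : (Fin d → ℝ) → ℝ) x‖ ≤ N) → ∀ a b k q l,
        eLpNorm ((f * R a b k (M q l) : SP d) : (Fin d → ℝ) → ℝ) p (volume.restrict (cube d)) ≤
          K * (ENNReal.ofReal N * X) := by
      intro f hf a b k q l
      refine (eLp_mul f _ N hf p).trans ?_
      calc _ ≤ ENNReal.ofReal N * (K * X) := by
            gcongr
            exact (hKR a b k p hp _).trans (by gcongr; exact hM q l)
        _ = _ := by ring
    have hH : ∀ k, eLpNorm (Hf R v M k : (Fin d → ℝ) → ℝ) p (volume.restrict (cube d)) ≤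
        d * (d * (d * (K * (ENNReal.ofReal N * X)))) := by
      intro k
      unfold Hf
      refine (eLp_sum _ _ hp _ fun l _ => eLp_sum _ _ hp _ fun m _ => eLp_sum _ _ hp _
        fun q _ => hprod _ (hdv m l) k m q q l).trans ?_
      simp
    have h1 : eLpNorm ((∑ l, ∑ k, v l * R a b k (M k l) : SP d) : (Fin d → ℝ) → ℝ) p
        (volume.restrict (cube d)) ≤ d * (d * (K * (ENNReal.ofReal N * X))) := by
      refine (eLp_sum _ _ hp _ fun l _ => eLp_sum _ _ hp _ fun k _ =>
        hprod _ (hv l) a b k k l).trans ?_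
      simp
    have h2 : eLpNorm ((∑ k, R a b k (Hf R v M k) : SP d) : (Fin d → ℝ) → ℝ) p
        (volume.restrict (cube d)) ≤
        d * (K * (d * (d * (d * (K * (ENNReal.ofReal N * X)))))) := by
      refine (eLp_sum _ _ hp _ fun k _ => (hKR a b k p hp _).trans
        (mul_le_mul_right (hH k) K)).trans ?_
      simp
    unfold Bf
    refine (eLpNorm_sub_le (SP.aesm _ _) (SP.aesm _ _) hp).trans ((add_le_add h1 h2).trans ?_)
    apply le_of_eq
    ring

theorem exists_proj (d : ℕ) : ∃ P : ((Fin d → ℝ) → ℝ) →ₗ[ℝ] SP d,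
    ∀ f, ∀ hf : f ∈ SP d, P f = ⟨f, hf⟩ := by
  obtain ⟨P, hP⟩ := LinearMap.exists_leftInverse_of_injective (SP d).val.toLinearMap
    (LinearMap.ker_eq_bot.2 Subtype.val_injective)
  exact ⟨P, fun f hf => LinearMap.congr_fun hP ⟨f, hf⟩⟩

theorem eLp_matrix {d : ℕ} (F : Fin d → Fin d → SP d) {p : ℝ≥0∞} (hp : 1 ≤ p) (X : ℝ≥0∞)
    (h : ∀ a b, eLpNorm (F a b : (Fin d → ℝ) → ℝ) p (volume.restrict (cube d)) ≤ X) :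
    eLpNorm (fun x a b => (F a b : (Fin d → ℝ) → ℝ) x) p (volume.restrict (cube d)) ≤
      d * (d * X) := by
  have h1 : ∀ x, ‖(fun a b => (F a b : (Fin d → ℝ) → ℝ) x)‖ ≤
      ∑ a, ∑ b, ‖(F a b : (Fin d → ℝ) → ℝ) x‖ := by
    intro x
    have hn : ∀ a, 0 ≤ ∑ b, ‖(F a b : (Fin d → ℝ) → ℝ) x‖ :=
      fun a => Finset.sum_nonneg fun b _ => norm_nonneg _
    refine (pi_norm_le_iff_of_nonneg (Finset.sum_nonneg fun a _ => hn a)).2 fun a => ?_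
    refine le_trans ?_ (Finset.single_le_sum (fun a _ => hn a) (Finset.mem_univ a))
    refine (pi_norm_le_iff_of_nonneg (hn a)).2 fun b => ?_
    exact Finset.single_le_sum (f := fun b => ‖(F a b : (Fin d → ℝ) → ℝ) x‖)
      (fun b _ => norm_nonneg _) (Finset.mem_univ b)
  refine (eLpNorm_mono_real h1).trans ?_
  have e : (fun x => ∑ a, ∑ b, ‖(F a b : (Fin d → ℝ) → ℝ) x‖) =
      ∑ a, ∑ b, fun x => ‖(F a b : (Fin d → ℝ) → ℝ) x‖ := by
    funext x
    simp
  have hm : ∀ a b, AEStronglyMeasurable (fun x => ‖(F a b : (Fin d → ℝ) → ℝ) x‖)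
      (volume.restrict (cube d)) := fun a b => (SP.aesm (F a b) _).norm
  rw [e]
  refine (eLpNorm_sum_le (fun a _ => Finset.aestronglyMeasurable_sum _ fun b _ => hm a b) hp).trans ?_
  refine (Finset.sum_le_card_nsmul _ _ (d * X) fun a _ => ?_).trans (by simp)
  refine (eLpNorm_sum_le (fun b _ => hm a b) hp).trans ?_
  refine (Finset.sum_le_card_nsmul _ _ X fun b _ => ?_).trans (by simp)
  rw [eLpNorm_norm]
  exact h a b

theorem C1_bounds {d : ℕ} (v : (Fin d → ℝ) → Fin d → ℝ) (hv : SmoothField d v) :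
    (∀ l x, ‖v x l‖ ≤ C1NormVec v) ∧
    (∀ m l x, ‖pd m (fun y => v y l) x‖ ≤ C1NormVec v) := by
  have hc : Continuous v := hv.1.continuous
  have hfc : Continuous (fderiv ℝ v) := hv.1.continuous_fderiv (by simp)
  have hdv : Differentiable ℝ v := hv.1.differentiable (by simp)
  obtain ⟨A, hA0, hA⟩ := periodic_bounded hc hv.2
  obtain ⟨B, hB0, hB⟩ := periodic_bounded hfc (periodic_fderiv hv.2)
  have b1 : BddAbove (Set.range fun x => ‖v x‖) := ⟨A, by rintro _ ⟨x, rfl⟩; exact hA x⟩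
  have b2 : ∀ i : Fin d, BddAbove (Set.range fun x =>
      ‖fderiv ℝ v x (Pi.single i 1)‖) := by
    intro i
    refine ⟨B * ‖(Pi.single i 1 : Fin d → ℝ)‖, ?_⟩
    rintro _ ⟨x, rfl⟩
    exact ((fderiv ℝ v x).le_opNorm _).trans (mul_le_mul_of_nonneg_right (hB x) (norm_nonneg _))
  have n1 : 0 ≤ ⨆ x, ‖v x‖ := Real.iSup_nonneg fun x => norm_nonneg _
  have n2 : ∀ i : Fin d, 0 ≤ ⨆ x, ‖fderiv ℝ v x (Pi.single i 1)‖ :=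
    fun i => Real.iSup_nonneg fun x => norm_nonneg _
  refine ⟨fun l x => ?_, fun m l x => ?_⟩
  · unfold C1NormVec
    have h1 : ‖v x l‖ ≤ ⨆ x, ‖v x‖ := (norm_le_pi_norm (v x) l).trans (le_ciSup b1 x)
    have h2 := Finset.sum_nonneg fun i (_ : i ∈ Finset.univ) => n2 i
    linarith
  · unfold C1NormVec
    have h0 : pd m (fun y => v y l) x = fderiv ℝ v x (Pi.single m 1) l := by
      unfold pd
      rw [fderiv_apply (hdv x)]
      rfl
    have h1 : ‖pd m (fun y => v y l) x‖ ≤ ⨆ x, ‖fderiv ℝ v x (Pi.single m 1)‖ := by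
      rw [h0]
      exact (norm_le_pi_norm (fderiv ℝ v x (Pi.single m 1)) l).trans (le_ciSup (b2 m) x)
    have h2 := Finset.single_le_sum (fun i (_ : i ∈ Finset.univ) => n2 i) (Finset.mem_univ m)
    linarith

/-- **Bilinear anti-divergence operator.**
For `d ≥ 2` there is a bilinear operator `ℬ` mapping a smooth vector field `v` and a
smooth mean-zero matrix field `M` on `𝕋^d` to a smooth symmetric trace-free matrix
field `ℬ(v,M)` with `div(ℬ(v,M)) = Mv − ∫ Mv` and
`‖ℬ(v,M)‖_{L^p} ≤ C_p ‖v‖_{C¹} ‖M‖_{L^p}` for every `p ∈ [1,∞]`. -/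
theorem bilinear_anti_divergence_operator (d : ℕ) (hd : 2 ≤ d) :
    ∃ B : ((Fin d → ℝ) → Fin d → ℝ) → ((Fin d → ℝ) → Fin d → Fin d → ℝ) →
          ((Fin d → ℝ) → Fin d → Fin d → ℝ),
      -- `ℬ` is bilinear
      (∀ M, IsLinearMap ℝ (fun v => B v M)) ∧
      (∀ v, IsLinearMap ℝ (B v)) ∧
      -- `ℬ(v,M)` is a smooth symmetric trace-free matrix field and
      -- (i) `div(ℬ(v,M)) = Mv − ∫ Mv`
      (∀ v M, SmoothField d v → SmoothMeanZeroMatrix d M →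
        ContDiff ℝ (⊤ : ℕ∞) (B v M) ∧ ZPeriodic (B v M) ∧
        (∀ x i j, B v M x i j = B v M x j i) ∧
        (∀ x, ∑ i, B v M x i i = 0) ∧
        (∀ x i, ∑ j, pd j (fun y => B v M y i j) x
          = (∑ j, M x i j * v x j) - ∫ y in cube d, ∑ j, M y i j * v y j)) ∧
      -- (ii) `L^p` bounds
      (∀ p : ℝ≥0∞, 1 ≤ p → ∃ C : ℝ, 0 < C ∧
        ∀ v M, SmoothField d v → SmoothMeanZeroMatrix d M →
          eLpNorm (B v M) p (volume.restrict (cube d))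
            ≤ ENNReal.ofReal (C * C1NormVec v) *
                eLpNorm M p (volume.restrict (cube d))) := by
  obtain ⟨R, hR1, hR2, hR3, hR4⟩ := antidiv d hd
  obtain ⟨P, hP⟩ := exists_proj d
  obtain ⟨K, hK, hB⟩ := Bf_bound R hR1
  have pv : ∀ v : (Fin d → ℝ) → Fin d → ℝ, SmoothField d v → ∀ l, (fun x => v x l) ∈ SP d := by
    intro v hv l
    refine ⟨(contDiff_pi.1 hv.1) l, fun x k => ?_⟩
    exact congrFun (hv.2 x k) l
  have pM : ∀ M : (Fin d → ℝ) → Fin d → Fin d → ℝ, SmoothMeanZeroMatrix d M →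
      ∀ k l, (fun x => M x k l) ∈ SP d := by
    intro M hM k l
    refine ⟨contDiff_pi.1 ((contDiff_pi.1 hM.1) k) l, fun x n => ?_⟩
    exact congrFun (congrFun (hM.2.1 x n) k) l
  let vc : ((Fin d → ℝ) → Fin d → ℝ) → Fin d → SP d := fun v l => P (fun x => v x l)
  let Mc : ((Fin d → ℝ) → Fin d → Fin d → ℝ) → Fin d → Fin d → SP d :=
    fun M k l => P (fun x => M x k l)
  have vadd : ∀ v v', vc (v + v') = vc v + vc v' := fun v v' => by
    funext l; exact map_add P (fun x => v x l) (fun x => v' x l)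
  have vsmul : ∀ (c : ℝ) v, vc (c • v) = c • vc v := fun c v => by
    funext l; exact map_smul P c (fun x => v x l)
  have madd : ∀ M M', Mc (M + M') = Mc M + Mc M' := fun M M' => by
    funext k l; exact map_add P (fun x => M x k l) (fun x => M' x k l)
  have msmul : ∀ (c : ℝ) M, Mc (c • M) = c • Mc M := fun c M => by
    funext k l; exact map_smul P c (fun x => M x k l)
  refine ⟨fun v M x a b => (Bf R (vc v) (Mc M) a b : (Fin d → ℝ) → ℝ) x, ?_, ?_, ?_, ?_⟩
  · intro M
    refine ⟨fun v v' => ?_, fun c v => ?_⟩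
    · funext x a b
      simp only [vadd, Bf_add_left]
      rfl
    · funext x a b
      simp only [vsmul, Bf_smul_left]
      rfl
  · intro v
    refine ⟨fun M M' => ?_, fun c M => ?_⟩
    · funext x a b
      simp only [madd, Bf_add_right]
      rfl
    · funext x a b
      simp only [msmul, Bf_smul_right]
      rfl
  · intro v M hv hM
    refine ⟨?_, ?_, ?_, ?_, ?_⟩
    · exact contDiff_pi.2 fun a => contDiff_pi.2 fun b => SP.smooth _
    · intro x k
      funext a b
      exact SP.per (Bf R (vc v) (Mc M) a b) x k
    · intro x a b
      simp only
      rw [Bf_symm R hR2]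
    · intro x
      have h := Bf_trace R hR3 (vc v) (Mc M)
      have h2 : ((∑ a, Bf R (vc v) (Mc M) a a : SP d) : (Fin d → ℝ) → ℝ) x = 0 := by
        rw [h]; rfl
      have e : ((∑ a, Bf R (vc v) (Mc M) a a : SP d) : (Fin d → ℝ) → ℝ) =
          ∑ a, (Bf R (vc v) (Mc M) a a : (Fin d → ℝ) → ℝ) := map_sum (SP d).val _ _
      rw [e, Finset.sum_apply] at h2
      exact h2
    · intro x a
      have hvc : ∀ l, vc v l = ⟨fun x => v x l, pv v hv l⟩ := fun l => hP _ _
      have hMc : ∀ k l, Mc M k l = ⟨fun x => M x k l, pM M hM k l⟩ := fun k l => hP _ _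
      have hz : ∀ k l, PartAvg d d (Mc M k l) = 0 := by
        intro k l
        ext y
        rw [PartAvg_eq, hMc]
        exact hM.2.2 k l
      have h := Bf_div R hR4 (vc v) (Mc M) hz a
      have e : ((∑ b, Dop b (Bf R (vc v) (Mc M) a b) : SP d) : (Fin d → ℝ) → ℝ) =
          ∑ b, (Dop b (Bf R (vc v) (Mc M) a b) : (Fin d → ℝ) → ℝ) := map_sum (SP d).val _ _
      have e2 : ((∑ l, vc v l * Mc M a l : SP d) : (Fin d → ℝ) → ℝ) =
          fun x => ∑ l, M x a l * v x l := by
        have e3 : ((∑ l, vc v l * Mc M a l : SP d) : (Fin d → ℝ) → ℝ) =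
          ∑ l, ((vc v l * Mc M a l : SP d) : (Fin d → ℝ) → ℝ) := map_sum (SP d).val _ _
        rw [e3]
        funext y
        rw [Finset.sum_apply]
        refine Finset.sum_congr rfl fun l _ => ?_
        rw [hvc, hMc]
        exact mul_comm _ _
      have h2 := congrFun (congrArg Subtype.val h) x
      rw [e, Finset.sum_apply] at h2
      refine Eq.trans h2 ?_
      change ((∑ l, vc v l * Mc M a l : SP d) : (Fin d → ℝ) → ℝ) x -
        (PartAvg d d (∑ l, vc v l * Mc M a l) : (Fin d → ℝ) → ℝ) x = _
      rw [PartAvg_eq, e2]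
  · intro p hp
    refine ⟨(d * (d * K)).toReal + 1, by positivity, fun v M hv hM => ?_⟩
    have hvc : ∀ l, vc v l = ⟨fun x => v x l, pv v hv l⟩ := fun l => hP _ _
    have hMc : ∀ k l, Mc M k l = ⟨fun x => M x k l, pM M hM k l⟩ := fun k l => hP _ _
    obtain ⟨c1, c2⟩ := C1_bounds v hv
    have h := hB p hp (vc v) (Mc M) (C1NormVec v) (eLpNorm M p (volume.restrict (cube d)))
      (fun l x => by rw [hvc]; exact c1 l x)
      (fun m l x => by rw [hvc]; exact c2 m l x)
      (fun k l => by
        rw [hMc]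
        refine eLpNorm_mono fun x => ?_
        exact (norm_le_pi_norm (M x k) l).trans (norm_le_pi_norm (M x) k))
    refine (eLp_matrix (Bf R (vc v) (Mc M)) hp _ h).trans ?_
    rw [ENNReal.ofReal_mul (by positivity)]
    have hKf : (d * (d * K) : ℝ≥0∞) ≠ ∞ := by finiteness
    have hle : (d * (d * K) : ℝ≥0∞) ≤ ENNReal.ofReal ((d * (d * K) : ℝ≥0∞).toReal + 1) := by
      conv_lhs => rw [← ENNReal.ofReal_toReal hKf]
      exact ENNReal.ofReal_le_ofReal (by linarith)
    calc (d : ℝ≥0∞) * (d * (K * (ENNReal.ofReal (C1NormVec v) *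
          eLpNorm M p (volume.restrict (cube d)))))
        = d * (d * K) * (ENNReal.ofReal (C1NormVec v) *
          eLpNorm M p (volume.restrict (cube d))) := by ring
      _ ≤ ENNReal.ofReal ((d * (d * K) : ℝ≥0∞).toReal + 1) * (ENNReal.ofReal (C1NormVec v) *
          eLpNorm M p (volume.restrict (cube d))) := by gcongr
      _ = _ := by ring
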